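/- For M > 0 and s > −1, log N_{[]}(ε, P_{M,s}, H) ≲ ε^{−1/2}, where H is the Hellinger distance and the implicit constant depends only on M and s. -/

import Mathlib

open MeasureTheory
open scoped ENNReal

/-- `s`-concavity via generalized means of order `s` (geometric mean for `s = 0`). -/
def IsSConc (s : ℝ) (p : ℝ → ℝ) : Prop :=
  ∀ x y θ : ℝ, 0 ≤ θ → θ ≤ 1 → 0 < p x → 0 < p y →
    (s = 0 → p x ^ (1 - θ) * p y ^ θ ≤ p ((1 - θ) * x + θ * y)) ∧
    (s ≠ 0 → ((1 - θ) * p x ^ s + θ * p y ^ s) ^ (1 / s) ≤ p ((1 - θ) * x + θ * y))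

/-- The class `P_{M,s}`. -/
def PMs (M s : ℝ) : Set (ℝ → ℝ) :=
  {p | (∀ x, 0 ≤ p x) ∧ (∫ x, p x = 1) ∧ IsSConc s p ∧
       (∀ x, p x ≤ M) ∧ (∀ x : ℝ, |x| ≤ 1 → 1 / M ≤ p x)}

/-- `BrackH F ε N`: `N` brackets of Hellinger size at most `ε` covering `F`, where
`H(l,u)² = (1/2)∫(√u − √l)² dλ`. -/
def BrackH (F : Set (ℝ → ℝ)) (ε : ℝ) (N : ℕ) : Prop :=
  ∃ l u : Fin N → ℝ → ℝ,
    (∀ i, (1 / 2 : ℝ≥0∞) *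
        ∫⁻ x, ENNReal.ofReal ((Real.sqrt (u i x) - Real.sqrt (l i x)) ^ 2) ≤
      ENNReal.ofReal (ε ^ 2)) ∧
    ∀ f ∈ F, ∃ i, ∀ x, l i x ≤ f x ∧ f x ≤ u i x

/-- Internal bracketing notion: squared size at most `E`, cardinality at most `exp A`. -/
def Br (F : Set (ℝ → ℝ)) (E A : ℝ) : Prop :=
  ∃ (ι : Type) (_ : Fintype ι) (l u : ι → ℝ → ℝ) (g : ι → ℝ → ℝ≥0∞),
    (Fintype.card ι : ℝ) ≤ Real.exp A ∧ (∀ i, Measurable (g i)) ∧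
    (∀ i x, 0 ≤ l i x) ∧ (∀ i x, 0 ≤ u i x) ∧
    (∀ i x, ENNReal.ofReal ((Real.sqrt (u i x) - Real.sqrt (l i x)) ^ 2) ≤ g i x) ∧
    (∀ i, ∫⁻ x, g i x ≤ ENNReal.ofReal E) ∧
    ∀ f ∈ F, ∃ i, ∀ x, l i x ≤ f x ∧ f x ≤ u i x

lemma Br.mono {F F' : Set (ℝ → ℝ)} {E E' A A' : ℝ} (h : Br F E A) (hF : F' ⊆ F) (hE : E ≤ E')
    (hA : A ≤ A') : Br F' E' A' := by
  obtain ⟨ι, hι, l, u, g, h1, h2, h3, h4, h5, h6, h7⟩ := h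
  exact ⟨ι, hι, l, u, g, h1.trans (Real.exp_le_exp.2 hA), h2, h3, h4, h5,
    fun i => (h6 i).trans (ENNReal.ofReal_le_ofReal hE), fun f hf => h7 f (hF hf)⟩

lemma sqrt_add_ineq (a b c d : ℝ) (ha : 0 ≤ a) (hb : 0 ≤ b) (hc : 0 ≤ c) (hd : 0 ≤ d) :
    (Real.sqrt (a + b) - Real.sqrt (c + d)) ^ 2 ≤
      (Real.sqrt a - Real.sqrt c) ^ 2 + (Real.sqrt b - Real.sqrt d) ^ 2 := by
  have h1 := Real.sq_sqrt ha
  have h2 := Real.sq_sqrt hb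
  have h3 := Real.sq_sqrt hc
  have h4 := Real.sq_sqrt hd
  have h5 := Real.sq_sqrt (add_nonneg ha hb)
  have h6 := Real.sq_sqrt (add_nonneg hc hd)
  have key : Real.sqrt a * Real.sqrt c + Real.sqrt b * Real.sqrt d ≤
      Real.sqrt (a + b) * Real.sqrt (c + d) := by
    apply le_of_sq_le_sq _ (by positivity)
    rw [mul_pow, h5, h6]
    nlinarith [sq_nonneg (Real.sqrt a * Real.sqrt d - Real.sqrt b * Real.sqrt c)]
  nlinarith

lemma Br.add {F₁ F₂ F : Set (ℝ → ℝ)} {E₁ E₂ A₁ A₂ : ℝ} (h₁ : Br F₁ E₁ A₁) (h₂ : Br F₂ E₂ A₂)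
    (hE₁ : 0 ≤ E₁) (hE₂ : 0 ≤ E₂)
    (hF : ∀ f ∈ F, ∃ f₁ ∈ F₁, ∃ f₂ ∈ F₂, ∀ x, f x = f₁ x + f₂ x) :
    Br F (E₁ + E₂) (A₁ + A₂) := by
  obtain ⟨ι, hι, l, u, g, h1, h2, h3, h4, h5, h6, h7⟩ := h₁
  obtain ⟨ι', hι', l', u', g', h1', h2', h3', h4', h5', h6', h7'⟩ := h₂
  refine ⟨ι × ι', inferInstance, fun i x => l i.1 x + l' i.2 x, fun i x => u i.1 x + u' i.2 x,
    fun i x => g i.1 x + g' i.2 x, ?_, fun i => (h2 _).add (h2' _),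
    fun i x => add_nonneg (h3 _ _) (h3' _ _), fun i x => add_nonneg (h4 _ _) (h4' _ _), ?_, ?_, ?_⟩
  · rw [Fintype.card_prod, Real.exp_add]
    push_cast
    gcongr
  · intro i x
    refine le_trans ?_ (add_le_add (h5 i.1 x) (h5' i.2 x))
    rw [← ENNReal.ofReal_add (sq_nonneg _) (sq_nonneg _)]
    exact ENNReal.ofReal_le_ofReal (sqrt_add_ineq _ _ _ _ (h4 _ _) (h4' _ _) (h3 _ _) (h3' _ _))
  · intro i
    rw [lintegral_add_left (h2 _), ENNReal.ofReal_add hE₁ hE₂]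
    exact add_le_add (h6 _) (h6' _)
  · intro f hf
    obtain ⟨f₁, hf₁, f₂, hf₂, hff⟩ := hF f hf
    obtain ⟨i, hi⟩ := h7 f₁ hf₁
    obtain ⟨j, hj⟩ := h7' f₂ hf₂
    refine ⟨(i, j), fun x => ?_⟩
    rw [hff]
    exact ⟨add_le_add (hi x).1 (hj x).1, add_le_add (hi x).2 (hj x).2⟩

lemma Br.sum {κ : Type} (S : Finset κ) (F : κ → Set (ℝ → ℝ)) (E A : κ → ℝ)
    (hE : ∀ i ∈ S, 0 ≤ E i) (h : ∀ i ∈ S, Br (F i) (E i) (A i)) :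
    Br {f | ∃ g : κ → ℝ → ℝ, (∀ i ∈ S, g i ∈ F i) ∧ ∀ x, f x = ∑ i ∈ S, g i x}
      (∑ i ∈ S, E i) (∑ i ∈ S, A i) := by
  classical
  induction S using Finset.induction_on with
  | empty =>
    refine ⟨Unit, inferInstance, fun _ _ => 0, fun _ _ => 0, fun _ _ => 0, by simp,
      fun _ => measurable_const, by simp, by simp, by simp, by simp, ?_⟩
    rintro f ⟨g, -, hg⟩
    exact ⟨(), fun x => by simp [hg]⟩
  | insert a S ha ih =>
    rw [Finset.sum_insert ha, Finset.sum_insert ha]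
    refine Br.add (h a (Finset.mem_insert_self _ _))
      (ih (fun i hi => hE i (Finset.mem_insert_of_mem hi))
        (fun i hi => h i (Finset.mem_insert_of_mem hi))) (hE a (Finset.mem_insert_self _ _))
      (Finset.sum_nonneg fun i hi => hE i (Finset.mem_insert_of_mem hi)) ?_
    rintro f ⟨g, hg, hfg⟩
    refine ⟨g a, hg a (Finset.mem_insert_self _ _), fun x => ∑ i ∈ S, g i x,
      ⟨g, fun i hi => hg i (Finset.mem_insert_of_mem hi), fun x => rfl⟩, fun x => ?_⟩
    rw [hfg, Finset.sum_insert ha]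

lemma lintegral_comp_div_pos (g : ℝ → ℝ≥0∞) (hg : Measurable g) (w : ℝ) (hw : 0 < w) :
    ∫⁻ x, g (x / w) = ENNReal.ofReal w * ∫⁻ x, g x := by
  have h := Real.map_volume_mul_left (a := w⁻¹) (by positivity)
  have h2 : ∫⁻ x, g x ∂(Measure.map (w⁻¹ * ·) volume) = ∫⁻ x, g (w⁻¹ * x) :=
    lintegral_map hg (by fun_prop)
  rw [h, lintegral_smul_measure] at h2
  simp only [inv_inv, abs_of_pos hw, smul_eq_mul] at h2
  rw [h2]
  congr 1; ext x; rw [div_eq_inv_mul]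

lemma Br.scale {F : Set (ℝ → ℝ)} {E A k w : ℝ} (h : Br F E A) (hk : 0 ≤ k)
    (hw : 0 < w) : Br {f | ∃ f' ∈ F, ∀ x, f x = k * f' (x / w)} (k * w * E) A := by
  obtain ⟨ι, hι, l, u, g, h1, h2, h3, h4, h5, h6, h7⟩ := h
  refine ⟨ι, hι, fun i x => k * l i (x / w), fun i x => k * u i (x / w),
    fun i x => ENNReal.ofReal k * g i (x / w), h1, fun i => ?_, fun i x => mul_nonneg hk (h3 _ _),
    fun i x => mul_nonneg hk (h4 _ _), fun i x => ?_, fun i => ?_, ?_⟩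
  · exact ((h2 i).comp (by fun_prop)).const_mul _
  · refine le_trans (le_of_eq ?_) (mul_le_mul_right (h5 i (x / w)) _)
    rw [← ENNReal.ofReal_mul hk, Real.sqrt_mul hk, Real.sqrt_mul hk]
    congr 1
    rw [← mul_sub, mul_pow, Real.sq_sqrt hk]
  · have hm : Measurable (fun x => g i (x / w)) := (h2 i).comp (by fun_prop)
    show ∫⁻ x, ENNReal.ofReal k * g i (x / w) ≤ _
    rw [lintegral_const_mul _ hm, lintegral_comp_div_pos _ (h2 i) _ hw,
      ENNReal.ofReal_mul (by positivity), ENNReal.ofReal_mul hk, mul_assoc]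
    gcongr
    exact h6 i
  · rintro f ⟨f', hf', hff⟩
    obtain ⟨i, hi⟩ := h7 f' hf'
    refine ⟨i, fun x => ?_⟩
    rw [hff]
    exact ⟨mul_le_mul_of_nonneg_left (hi _).1 hk, mul_le_mul_of_nonneg_left (hi _).2 hk⟩

lemma Br.neg {F : Set (ℝ → ℝ)} {E A : ℝ} (h : Br F E A) :
    Br {f | ∃ f' ∈ F, ∀ x, f x = f' (-x)} E A := by
  obtain ⟨ι, hι, l, u, g, h1, h2, h3, h4, h5, h6, h7⟩ := h
  refine ⟨ι, hι, fun i x => l i (-x), fun i x => u i (-x),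
    fun i x => g i (-x), h1, fun i => (h2 i).comp measurable_neg, fun i x => h3 _ _,
    fun i x => h4 _ _, fun i x => h5 _ _, fun i => ?_, ?_⟩
  · refine le_trans (le_of_eq ?_) (h6 i)
    exact (Measure.measurePreserving_neg (volume : Measure ℝ)).lintegral_comp (h2 i)
  · rintro f ⟨f', hf', hff⟩
    obtain ⟨i, hi⟩ := h7 f' hf'
    refine ⟨i, fun x => ?_⟩
    rw [hff]
    exact hi _

lemma Br.toBrackH {F : Set (ℝ → ℝ)} {E A ε : ℝ} (h : Br F E A) (hA : 0 ≤ A)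
    (hE : E ≤ 2 * ε ^ 2) : ∃ N : ℕ, BrackH F ε N ∧ Real.log N ≤ A := by
  obtain ⟨ι, hι, l, u, g, h1, h2, h3, h4, h5, h6, h7⟩ := h
  refine ⟨Fintype.card ι, ⟨fun i => l ((Fintype.equivFin ι).symm i),
    fun i => u ((Fintype.equivFin ι).symm i), fun i => ?_, fun f hf => ?_⟩, ?_⟩
  · have := (lintegral_mono (h5 ((Fintype.equivFin ι).symm i))).trans (h6 _)
    have h8 := this.trans (ENNReal.ofReal_le_ofReal hE)
    calc _ ≤ (1 / 2 : ℝ≥0∞) * ENNReal.ofReal (2 * ε ^ 2) := by gcongr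
      _ = _ := by
        rw [ENNReal.ofReal_mul (by norm_num), ← mul_assoc]
        simp [ENNReal.inv_mul_cancel]
  · obtain ⟨i, hi⟩ := h7 f hf
    exact ⟨Fintype.equivFin ι i, by simpa using hi⟩
  · rcases Nat.eq_zero_or_pos (Fintype.card ι) with h0 | h0
    · rw [h0]; simpa using hA
    · rw [Real.log_le_iff_le_exp (by exact_mod_cast h0)]
      exact h1

open MeasureTheory
open scoped ENNReal

/-- concave dual of `φ + quadratic` -/
noncomputable def hh (φ : ℝ → ℝ) (R : Set ℝ) (a σ : ℝ) : ℝ :=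
  sInf ((fun z => φ z + (z - a) ^ 2 / 2 - σ * (z - a)) '' R)

lemma hh_le {φ : ℝ → ℝ} {R : Set ℝ} {a σ x : ℝ} (h0 : ∀ x ∈ R, 0 ≤ φ x) (hx : x ∈ R) :
    hh φ R a σ ≤ φ x + (x - a) ^ 2 / 2 - σ * (x - a) := by
  refine csInf_le ⟨-σ ^ 2 / 2, ?_⟩ ⟨x, hx, rfl⟩
  rintro _ ⟨z, hz, rfl⟩
  have := h0 z hz
  simp only
  nlinarith [sq_nonneg (z - a - σ)]

lemma le_hh {φ : ℝ → ℝ} {R : Set ℝ} {a σ b : ℝ} (hR : R.Nonempty)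
    (h : ∀ x ∈ R, b ≤ φ x + (x - a) ^ 2 / 2 - σ * (x - a)) : b ≤ hh φ R a σ := by
  refine le_csInf (hR.image _) ?_
  rintro _ ⟨z, hz, rfl⟩
  exact h z hz

lemma hh_concave {φ : ℝ → ℝ} {R : Set ℝ} {a σ δ : ℝ} (hR : R.Nonempty)
    (h0 : ∀ x ∈ R, 0 ≤ φ x) :
    hh φ R a (σ + δ) + hh φ R a (σ - δ) ≤ 2 * hh φ R a σ := by
  have : (hh φ R a (σ + δ) + hh φ R a (σ - δ)) / 2 ≤ hh φ R a σ := by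
    apply le_hh hR
    intro x hx
    have h1 := hh_le (a := a) (σ := σ + δ) h0 hx
    have h2 := hh_le (a := a) (σ := σ - δ) h0 hx
    nlinarith
  linarith

lemma hh_lower {φ : ℝ → ℝ} {R : Set ℝ} {a σ δ : ℝ} (hR : R.Nonempty)
    (h0 : ∀ x ∈ R, 0 ≤ φ x) (hc : ConvexOn ℝ R φ) :
    2 * hh φ R a σ - δ ^ 2 ≤ hh φ R a (σ + δ) + hh φ R a (σ - δ) := by
  have key : ∀ z₁ ∈ R, ∀ z₂ ∈ R, 2 * hh φ R a σ - δ ^ 2 ≤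
      (φ z₁ + (z₁ - a) ^ 2 / 2 - (σ + δ) * (z₁ - a)) +
      (φ z₂ + (z₂ - a) ^ 2 / 2 - (σ - δ) * (z₂ - a)) := by
    intro z₁ h₁ z₂ h₂
    have hm := hc.1 h₁ h₂ (by norm_num : (0 : ℝ) ≤ 1 / 2) (by norm_num : (0 : ℝ) ≤ 1 / 2) (by norm_num)
    have hv := hc.2 h₁ h₂ (by norm_num : (0 : ℝ) ≤ 1 / 2) (by norm_num : (0 : ℝ) ≤ 1 / 2) (by norm_num)
    have := hh_le (a := a) (σ := σ) h0 hm
    simp only [smul_eq_mul] at hv this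
    nlinarith [sq_nonneg (z₁ - z₂ - 2 * δ)]
  have h1 : ∀ z₁ ∈ R, 2 * hh φ R a σ - δ ^ 2 -
      (φ z₁ + (z₁ - a) ^ 2 / 2 - (σ + δ) * (z₁ - a)) ≤ hh φ R a (σ - δ) := fun z₁ h₁ =>
    le_hh hR fun z₂ h₂ => by linarith [key z₁ h₁ z₂ h₂]
  have h2 : 2 * hh φ R a σ - δ ^ 2 - hh φ R a (σ - δ) ≤ hh φ R a (σ + δ) :=
    le_hh hR fun z₁ h₁ => by linarith [h1 z₁ h₁]
  linarith

lemma hh_sub {φ : ℝ → ℝ} {R : Set ℝ} {a σ x m : ℝ} (hx : x ∈ R)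
    (hm : ∀ z ∈ R, φ x + m * (z - x) ≤ φ z) :
    φ x + (x - a) ^ 2 / 2 - σ * (x - a) - (m + (x - a) - σ) ^ 2 / 2 ≤ hh φ R a σ := by
  refine le_hh ⟨x, hx⟩ fun z hz => ?_
  nlinarith [hm z hz, sq_nonneg (z - x + (m + (x - a) - σ))]

/-- decoding of second differences -/
def dec (a b : ℤ) (e : ℕ → ℤ) : ℕ → ℤ
  | 0 => a
  | 1 => b
  | (i + 2) => 2 * dec a b e (i + 1) - dec a b e i + e i

lemma dec_eq (s : ℕ → ℤ) (e : ℕ → ℤ) (n : ℕ)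
    (he : ∀ i < n, e i = s (i + 2) - 2 * s (i + 1) + s i) :
    ∀ i ≤ n, dec (s 0) (s 1) e i = s i ∧ dec (s 0) (s 1) e (i + 1) = s (i + 1) := by
  intro i
  induction i with
  | zero => intro _; simp [dec]
  | succ i ih =>
    intro hi
    obtain ⟨h1, h2⟩ := ih (by omega)
    refine ⟨h2, ?_⟩
    rw [dec, h1, h2, he i (by omega)]
    ring

/-- codes -/
abbrev Cd (T n : ℕ) : Type :=
  {z // z ∈ Finset.Icc (-(T : ℤ)) T} × {z // z ∈ Finset.Icc (-(T : ℤ)) T} ×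
    (Fin n → {z // z ∈ Finset.Icc (-2 : ℤ) 1})

def Cd.seq {T n : ℕ} (w : Cd T n) : ℕ → ℤ :=
  dec w.1 w.2.1 (fun i => if h : i < n then (w.2.2 ⟨i, h⟩ : ℤ) else 0)

lemma card_Cd (T n : ℕ) : Fintype.card (Cd T n) = (2 * T + 1) * ((2 * T + 1) * 4 ^ n) := by
  have : (T + 1 + T : ℤ).toNat = 2 * T + 1 := by omega
  simp [Cd, this]

noncomputable def AA (L δ a : ℝ) (n : ℕ) (s : ℕ → ℤ) (x : ℝ) : ℝ :=
  (Finset.range (n + 1)).sup' ⟨0, by simp⟩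
    (fun i => δ ^ 2 * s i + (-L + i * δ) * (x - a)) - (x - a) ^ 2 / 2

lemma code_exists {φ : ℝ → ℝ} {R : Set ℝ} {a L δ : ℝ} {T n : ℕ} (hR : R.Nonempty)
    (h0 : ∀ x ∈ R, 0 ≤ φ x) (h1 : ∀ x ∈ R, φ x ≤ 1) (hc : ConvexOn ℝ R φ)
    (ha : ∀ x ∈ R, 0 ≤ x - a ∧ x - a ≤ 2) (hL : 0 ≤ L) (hδ : 0 < δ) (hδ1 : δ ≤ 1)
    (hm : ∀ x ∈ R, ∃ m, |m| ≤ L ∧ ∀ z ∈ R, φ x + m * (z - x) ≤ φ z)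
    (hn : (2 * L + 2) / δ ≤ n)
    (hT : (3 + 2 * (L + 1) + (L + 1) ^ 2) / δ ^ 2 + 1 ≤ T) :
    ∃ w : Cd T n, ∀ x ∈ R, AA L δ a n w.seq x ≤ φ x ∧ φ x ≤ AA L δ a n w.seq x + 2 * δ ^ 2 := by
  have hδ2 : 0 < δ ^ 2 := by positivity
  set t : ℕ → ℝ := fun i => hh φ R a (-L + i * δ) with ht
  set s : ℕ → ℤ := fun i => ⌊t i / δ ^ 2⌋ with hs
  have hs1 : ∀ i, δ ^ 2 * s i ≤ t i := fun i => by
    have := Int.floor_le (t i / δ ^ 2)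
    rw [le_div_iff₀ hδ2] at this
    linarith
  have hs2 : ∀ i, t i < δ ^ 2 * s i + δ ^ 2 := fun i => by
    have := Int.lt_floor_add_one (t i / δ ^ 2)
    rw [div_lt_iff₀ hδ2] at this
    linarith
  have htb : ∀ σ : ℝ, |σ| ≤ L + 1 → |hh φ R a σ| ≤ 3 + 2 * (L + 1) + (L + 1) ^ 2 := by
    intro σ hσ
    obtain ⟨x, hx⟩ := hR
    have h2 := hh_le (a := a) (σ := σ) h0 hx
    have h3 : -σ ^ 2 / 2 ≤ hh φ R a σ := le_hh ⟨x, hx⟩ fun z hz => by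
      nlinarith [sq_nonneg (z - a - σ), h0 z hz]
    have h4 := ha x hx
    have h5 := h1 x hx
    have h6 := abs_le.1 hσ
    rw [abs_le]
    constructor
    · nlinarith
    · nlinarith
  have hsT : ∀ i, |t i| ≤ 3 + 2 * (L + 1) + (L + 1) ^ 2 → s i ∈ Finset.Icc (-(T : ℤ)) T := by
    intro i hi
    have h2 := abs_le.1 hi
    have e1 : t i / δ ^ 2 ≤ (3 + 2 * (L + 1) + (L + 1) ^ 2) / δ ^ 2 := by gcongr; exact h2.2
    have e2 : -((3 + 2 * (L + 1) + (L + 1) ^ 2) / δ ^ 2) ≤ t i / δ ^ 2 := by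
      rw [← neg_div]; gcongr; exact h2.1
    rw [Finset.mem_Icc]
    have f1 := Int.floor_le (t i / δ ^ 2)
    have f2 := Int.lt_floor_add_one (t i / δ ^ 2)
    constructor
    · have : (-(T : ℤ) : ℝ) ≤ (s i : ℝ) := by push_cast; simp only [hs]; linarith
      exact_mod_cast this
    · have : (s i : ℝ) ≤ ((T : ℤ) : ℝ) := by push_cast; simp only [hs]; linarith
      exact_mod_cast this
  have hd : ∀ i, s (i + 2) - 2 * s (i + 1) + s i ∈ Finset.Icc (-2 : ℤ) 1 := by
    intro i
    have e1 : (-L + ((i + 1 : ℕ) : ℝ) * δ) + δ = -L + ((i + 2 : ℕ) : ℝ) * δ := by push_cast; ring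
    have e2 : (-L + ((i + 1 : ℕ) : ℝ) * δ) - δ = -L + (i : ℝ) * δ := by push_cast; ring
    have g1 := hh_concave (a := a) (σ := -L + ((i + 1 : ℕ) : ℝ) * δ) (δ := δ) hR h0
    have g2 := hh_lower (a := a) (σ := -L + ((i + 1 : ℕ) : ℝ) * δ) (δ := δ) hR h0 hc
    rw [e1, e2] at g1 g2
    change t (i + 2) + t i ≤ 2 * t (i + 1) at g1
    change 2 * t (i + 1) - δ ^ 2 ≤ t (i + 2) + t i at g2
    have a1 := hs1 i
    have a2 := hs1 (i + 1)
    have a3 := hs1 (i + 2)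
    have b1 := hs2 i
    have b2 := hs2 (i + 1)
    have b3 := hs2 (i + 2)
    rw [Finset.mem_Icc]
    constructor
    · by_contra hcon
      have : s (i + 2) - 2 * s (i + 1) + s i ≤ -3 := by omega
      have h' : (s (i + 2) : ℝ) - 2 * s (i + 1) + s i ≤ -3 := by exact_mod_cast this
      nlinarith
    · by_contra hcon
      have : 2 ≤ s (i + 2) - 2 * s (i + 1) + s i := by omega
      have h' : (2 : ℝ) ≤ s (i + 2) - 2 * s (i + 1) + s i := by exact_mod_cast this
      nlinarith
  let w : Cd T n := (⟨s 0, hsT 0 (htb _ (by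
      simp only [Nat.cast_zero, zero_mul, add_zero, abs_neg, abs_of_nonneg hL]; linarith))⟩,
    ⟨s 1, hsT 1 (htb _ (by
      rw [abs_le]; push_cast; constructor <;> linarith))⟩,
    fun i => ⟨s (i + 2) - 2 * s (i + 1) + s i, hd i⟩)
  have hw : ∀ i ≤ n, w.seq i = s i := by
    intro i hi
    refine (dec_eq s _ n ?_ i hi).1
    intro i hi
    simp [hi, w]
  refine ⟨w, fun x hx => ⟨?_, ?_⟩⟩
  · rw [AA, sub_le_iff_le_add]
    apply Finset.sup'_le
    intro i hi
    rw [hw i (by simpa [Nat.lt_succ_iff] using hi)]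
    have := hh_le (a := a) (σ := -L + i * δ) h0 hx
    have := hs1 i
    linarith
  · obtain ⟨m, hm1, hm2⟩ := hm x hx
    have hxa := ha x hx
    have hm3 := abs_le.1 hm1
    set i := ⌊(m + (x - a) + L) / δ⌋₊ with hi
    have hnn : 0 ≤ (m + (x - a) + L) / δ := div_nonneg (by linarith) hδ.le
    have i1 : (i : ℝ) ≤ (m + (x - a) + L) / δ := Nat.floor_le hnn
    have i2 : (m + (x - a) + L) / δ < i + 1 := Nat.lt_floor_add_one _
    have hin : i ≤ n := by
      have : (m + (x - a) + L) / δ ≤ (2 * L + 2) / δ :=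
        div_le_div_of_nonneg_right (by linarith) hδ.le
      exact_mod_cast i1.trans (this.trans hn)
    rw [le_div_iff₀ hδ] at i1
    rw [div_lt_iff₀ hδ] at i2
    have h2 := hh_sub (a := a) (σ := -L + i * δ) hx hm2
    have h3 := hs2 i
    have h4 : (δ ^ 2 * w.seq i + (-L + i * δ) * (x - a)) ≤
      (Finset.range (n + 1)).sup' ⟨0, by simp⟩
        (fun i => δ ^ 2 * (w.seq i : ℝ) + (-L + i * δ) * (x - a)) :=
      Finset.le_sup' (fun i : ℕ => δ ^ 2 * (w.seq i : ℝ) + (-L + i * δ) * (x - a))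
        (Finset.mem_range.2 (Nat.lt_succ_of_le hin))
    rw [hw i hin] at h4
    change _ ≤ t i at h2
    have h5 : (m + (x - a) - (-L + i * δ)) ^ 2 ≤ δ ^ 2 := by
      apply pow_le_pow_left₀ <;> linarith
    rw [AA]
    linarith

lemma sqrt_rpow_diff {r c W e : ℝ} (hr : 0 < r) (hr2 : r ≤ 2) (hc : 0 < c) (hW : c ≤ W)
    (he : 0 ≤ e) :
    (Real.sqrt (W ^ (-r)) - Real.sqrt ((W + e) ^ (-r))) ^ 2 ≤ c ^ (-r) * (e / c) ^ 2 := by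
  have hW0 : 0 < W := hc.trans_le hW
  set q := W / (W + e) with hq
  have hq0 : 0 < q := by positivity
  have hq1 : q ≤ 1 := by rw [hq, div_le_one (by positivity)]; linarith
  have h1 : (W + e) ^ (-r) = W ^ (-r) * q ^ r := by
    rw [hq, Real.div_rpow hW0.le (by positivity), Real.rpow_neg (by positivity),
      Real.rpow_neg hW0.le]
    have := (Real.rpow_pos_of_pos hW0 r).ne'
    field_simp
  have h2 : q ≤ Real.sqrt (q ^ r) := by
    apply Real.le_sqrt_of_sq_le
    rw [← Real.rpow_natCast]
    exact Real.rpow_le_rpow_of_exponent_ge hq0 hq1 (by exact_mod_cast hr2)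
  have h3 : Real.sqrt (q ^ r) ≤ 1 := by
    refine Real.sqrt_le_iff.2 ⟨zero_le_one, ?_⟩
    rw [one_pow]
    exact Real.rpow_le_one hq0.le hq1 hr.le
  have hWr : 0 ≤ W ^ (-r) := by positivity
  rw [h1, Real.sqrt_mul hWr]
  have h4 : (Real.sqrt (W ^ (-r)) - Real.sqrt (W ^ (-r)) * Real.sqrt (q ^ r)) ^ 2 =
      W ^ (-r) * (1 - Real.sqrt (q ^ r)) ^ 2 := by
    rw [← mul_one_sub, mul_pow, Real.sq_sqrt hWr]
  rw [h4]
  have h5 : 1 - Real.sqrt (q ^ r) ≤ e / c := by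
    have : 1 - q = e / (W + e) := by rw [hq]; field_simp; ring
    have h6 : e / (W + e) ≤ e / c := by gcongr; linarith
    linarith
  gcongr ?_ * ?_ ^ 2
  · exact Real.rpow_le_rpow_of_nonpos hc hW (by linarith)
open MeasureTheory
open scoped ENNReal

/-- normalized pieces -/
def PC (r c L X : ℝ) : Set (ℝ → ℝ) :=
  {f | ∃ (R : Set ℝ) (φ : ℝ → ℝ), R.OrdConnected ∧ (∀ x ∈ R, 0 ≤ x ∧ x ≤ X) ∧
    (∀ x ∈ R, ∀ y ∈ R, y - x ≤ 1) ∧ ConvexOn ℝ R φ ∧ (∀ x ∈ R, c ≤ φ x ∧ φ x ≤ 1) ∧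
    (∀ x ∈ R, ∃ m, |m| ≤ L ∧ ∀ z ∈ R, φ x + m * (z - x) ≤ φ z) ∧
    (∀ x ∈ R, f x = φ x ^ (-r)) ∧ ∀ x, x ∉ R → f x = 0}

lemma piece_card {L X δ : ℝ} (hL : 0 ≤ L) (hX : 0 ≤ X) (hδ : 0 < δ) (hδ1 : δ ≤ 1) :
    (((⌊X / δ ^ 4⌋₊ + 1) * ((⌊1 / δ ^ 4⌋₊ + 2) *
      ((2 * (⌈(3 + 2 * (L + 1) + (L + 1) ^ 2) / δ ^ 2⌉₊ + 1) + 1) *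
      ((2 * (⌈(3 + 2 * (L + 1) + (L + 1) ^ 2) / δ ^ 2⌉₊ + 1) + 1) *
        4 ^ ⌈(2 * L + 2) / δ⌉₊))) : ℕ) : ℝ) ≤
      Real.exp ((12 + 3 * (2 * (3 + 2 * (L + 1) + (L + 1) ^ 2) + 5) ^ 2 + (4 * L + 6)) / δ +
        Real.log (X + 1)) := by
  set H := 3 + 2 * (L + 1) + (L + 1) ^ 2 with hH
  have hH0 : 0 ≤ H := by positivity
  have p4 : 0 < δ ^ 4 := by positivity
  have p2 : 0 < δ ^ 2 := by positivity
  have q4 : δ ^ 4 ≤ 1 := pow_le_one₀ hδ.le hδ1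
  have q2 : δ ^ 2 ≤ 1 := pow_le_one₀ hδ.le hδ1
  have o4 : 1 ≤ 1 / δ ^ 4 := by rw [le_div_iff₀ p4]; linarith
  have o2 : 1 ≤ 1 / δ ^ 2 := by rw [le_div_iff₀ p2]; linarith
  have h1 : ((⌊X / δ ^ 4⌋₊ : ℕ) : ℝ) + 1 ≤ (X + 1) * (1 / δ ^ 4) := by
    have := Nat.floor_le (div_nonneg hX p4.le)
    have e : (X + 1) * (1 / δ ^ 4) = X / δ ^ 4 + 1 / δ ^ 4 := by ring
    linarith
  have h2 : ((⌊1 / δ ^ 4⌋₊ : ℕ) : ℝ) + 2 ≤ 3 * (1 / δ ^ 4) := by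
    have := Nat.floor_le (div_nonneg zero_le_one p4.le)
    linarith
  have h3 : 2 * (((⌈H / δ ^ 2⌉₊ : ℕ) : ℝ) + 1) + 1 ≤ (2 * H + 5) * (1 / δ ^ 2) := by
    have := Nat.ceil_lt_add_one (div_nonneg hH0 p2.le)
    have e : (2 * H + 5) * (1 / δ ^ 2) = 2 * (H / δ ^ 2) + 5 * (1 / δ ^ 2) := by ring
    linarith
  have h4 : (4 : ℝ) ^ ⌈(2 * L + 2) / δ⌉₊ ≤ Real.exp ((4 * L + 6) / δ) := by
    have a1 : (4 : ℝ) ≤ Real.exp 2 := by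
      have := Real.add_one_le_exp (1 : ℝ)
      have e : Real.exp 2 = Real.exp 1 * Real.exp 1 := by rw [← Real.exp_add]; norm_num
      rw [e]; nlinarith
    calc (4 : ℝ) ^ ⌈(2 * L + 2) / δ⌉₊ ≤ (Real.exp 2) ^ ⌈(2 * L + 2) / δ⌉₊ := by gcongr
      _ = Real.exp (⌈(2 * L + 2) / δ⌉₊ * 2) := by rw [← Real.exp_nat_mul]
      _ ≤ _ := by
        rw [Real.exp_le_exp]
        have := Nat.ceil_lt_add_one (a := (2 * L + 2) / δ) (by positivity)
        have o1 : 1 ≤ 1 / δ := by rw [le_div_iff₀ hδ]; linarith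
        have e : (4 * L + 6) / δ = 2 * ((2 * L + 2) / δ) + 2 * (1 / δ) := by ring
        linarith
  have h5 : (1 / δ) ^ 12 ≤ Real.exp (12 / δ) := by
    have : 1 / δ ≤ Real.exp (1 / δ) := by linarith [Real.add_one_le_exp (1 / δ)]
    calc (1 / δ) ^ 12 ≤ (Real.exp (1 / δ)) ^ 12 := by gcongr
      _ = _ := by rw [← Real.exp_nat_mul]; congr 1; push_cast; ring
  have h6 : 3 * (2 * H + 5) ^ 2 ≤ Real.exp (3 * (2 * H + 5) ^ 2 / δ) := by
    have : 3 * (2 * H + 5) ^ 2 ≤ 3 * (2 * H + 5) ^ 2 / δ := by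
      rw [le_div_iff₀ hδ]; exact mul_le_of_le_one_right (by positivity) hδ1
    linarith [Real.add_one_le_exp (3 * (2 * H + 5) ^ 2 / δ)]
  push_cast
  calc _ ≤ ((X + 1) * (1 / δ ^ 4)) * ((3 * (1 / δ ^ 4)) * (((2 * H + 5) * (1 / δ ^ 2)) *
        (((2 * H + 5) * (1 / δ ^ 2)) * Real.exp ((4 * L + 6) / δ)))) := by gcongr
    _ = (1 / δ) ^ 12 * (3 * (2 * H + 5) ^ 2) * Real.exp ((4 * L + 6) / δ) * (X + 1) := by
        field_simp
    _ ≤ Real.exp (12 / δ) * Real.exp (3 * (2 * H + 5) ^ 2 / δ) * Real.exp ((4 * L + 6) / δ) *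
        (X + 1) := by gcongr
    _ = _ := by
        rw [Real.exp_add, Real.exp_log (by linarith), ← Real.exp_add, ← Real.exp_add]
        congr 2; ring

lemma piece {r c L : ℝ} (hr : 0 < r) (hr2 : r ≤ 2) (hc : 0 < c) (hL : 0 ≤ L) :
    ∃ K, 0 < K ∧ ∀ X δ, 0 ≤ X → 0 < δ → δ ≤ 1 →
      Br (PC r c L X) (K * δ ^ 4) (K / δ + Real.log (X + 1)) := by
  set H := 3 + 2 * (L + 1) + (L + 1) ^ 2 with hH
  set K1 := 12 + 3 * (2 * H + 5) ^ 2 + (4 * L + 6) with hK1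
  set K2 := c ^ (-r) * 2 + c ^ (-r) * (4 / c ^ 2) with hK2
  have hcr : 0 < c ^ (-r) := Real.rpow_pos_of_pos hc _
  have hK1p : 0 < K1 := by positivity
  have hK2p : 0 < K2 := by positivity
  refine ⟨K1 + K2, by positivity, fun X δ hX hδ hδ1 => ?_⟩
  suffices h : Br (PC r c L X) (K2 * δ ^ 4) (K1 / δ + Real.log (X + 1)) by
    refine h.mono subset_rfl ?_ ?_
    · gcongr; linarith
    · gcongr; linarith
  set n := ⌈(2 * L + 2) / δ⌉₊ with hn
  set T := ⌈H / δ ^ 2⌉₊ + 1 with hT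
  set ρ := δ ^ 4 with hρ
  have hρ0 : 0 < ρ := by positivity
  have hρ1 : ρ ≤ 1 := pow_le_one₀ hδ.le hδ1
  have hδ2 : 0 < δ ^ 2 := by positivity
  set n1 := ⌊X / ρ⌋₊ with hn1
  set n2 := ⌊1 / ρ⌋₊ with hn2
  let ι := Fin (n1 + 1) × Fin (n2 + 2) × Cd T n
  let a : ι → ℝ := fun i => ρ * (i.1 : ℕ)
  let b : ι → ℝ := fun i => ρ * ((i.1 : ℕ) + (i.2.1 : ℕ))
  let W : ι → ℝ → ℝ := fun i x => max (AA L δ (a i) n i.2.2.seq x) c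
  have hW : ∀ i x, c ≤ W i x := fun i x => le_max_right _ _
  have hW0 : ∀ i x, 0 < W i x := fun i x => hc.trans_le (hW i x)
  classical
  refine ⟨ι, inferInstance,
    fun i x => if x ∈ Set.Ioo (a i + ρ) (b i) then (W i x + 2 * δ ^ 2) ^ (-r) else 0,
    fun i x => if x ∈ Set.Icc (a i) (b i + ρ) then (W i x) ^ (-r) else 0,
    fun i x => (Set.Icc (a i) (a i + ρ) ∪ Set.Icc (b i) (b i + ρ)).indicator
        (fun _ => ENNReal.ofReal (c ^ (-r))) x +
      (Set.Ioo (a i + ρ) (b i)).indicator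
        (fun _ => ENNReal.ofReal (c ^ (-r) * (2 * δ ^ 2 / c) ^ 2)) x, ?_, ?_, ?_, ?_, ?_, ?_, ?_⟩
  · have := piece_card hL hX hδ hδ1
    rw [Fintype.card_prod, Fintype.card_prod, card_Cd, Fintype.card_fin, Fintype.card_fin]
    exact this
  · intro i
    exact (measurable_const.indicator (measurableSet_Icc.union measurableSet_Icc)).add
      (measurable_const.indicator measurableSet_Ioo)
  · intro i x
    have := hW0 i x
    dsimp only
    split_ifs
    · positivity
    · exact le_rfl
  · intro i x
    have := hW0 i x
    dsimp only
    split_ifs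
    · positivity
    · exact le_rfl
  · intro i x
    dsimp only
    by_cases hx : x ∈ Set.Ioo (a i + ρ) (b i)
    · have hx' : x ∈ Set.Icc (a i) (b i + ρ) := ⟨by linarith [hx.1], by linarith [hx.2]⟩
      rw [if_pos hx, if_pos hx', Set.indicator_of_mem hx]
      refine le_trans (ENNReal.ofReal_le_ofReal ?_) le_add_self
      exact sqrt_rpow_diff hr hr2 hc (hW i x) (by positivity)
    · rw [if_neg hx]
      by_cases hx' : x ∈ Set.Icc (a i) (b i + ρ)
      · have hx3 : x ∈ Set.Icc (a i) (a i + ρ) ∪ Set.Icc (b i) (b i + ρ) := by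
          by_contra hcon
          simp only [Set.mem_union, Set.mem_Icc, not_or, not_and, not_le] at hcon
          apply hx
          refine ⟨hcon.1 hx'.1, ?_⟩
          by_contra h7
          exact absurd (hcon.2 (not_lt.1 h7)) (not_lt.2 hx'.2)
        rw [if_pos hx', Set.indicator_of_mem hx3]
        refine le_trans (ENNReal.ofReal_le_ofReal ?_) le_self_add
        have := hW0 i x
        rw [Real.sqrt_zero, sub_zero, Real.sq_sqrt (by positivity)]
        exact Real.rpow_le_rpow_of_nonpos hc (hW i x) (by linarith)
      · rw [if_neg hx']; simp
  · intro i
    dsimp only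
    rw [lintegral_add_left (measurable_const.indicator (measurableSet_Icc.union measurableSet_Icc)),
      lintegral_indicator (measurableSet_Icc.union measurableSet_Icc),
      lintegral_indicator measurableSet_Ioo, setLIntegral_const, setLIntegral_const]
    have v1 : volume (Set.Icc (a i) (a i + ρ) ∪ Set.Icc (b i) (b i + ρ)) ≤
        ENNReal.ofReal (2 * ρ) := by
      refine (measure_union_le _ _).trans ?_
      rw [Real.volume_Icc, Real.volume_Icc, ← ENNReal.ofReal_add (by linarith) (by linarith)]
      apply ENNReal.ofReal_le_ofReal; linarith
    have v2 : volume (Set.Ioo (a i + ρ) (b i)) ≤ ENNReal.ofReal 1 := by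
      rw [Real.volume_Ioo]
      apply ENNReal.ofReal_le_ofReal
      have h8 : ((i.2.1 : ℕ) : ℝ) ≤ n2 + 1 := by exact_mod_cast Nat.lt_succ_iff.1 i.2.1.2
      have h9 : (n2 : ℝ) ≤ 1 / ρ := Nat.floor_le (by positivity)
      have h10 : ρ * (1 / ρ) = 1 := by field_simp
      simp only [a, b]
      nlinarith
    calc _ ≤ ENNReal.ofReal (c ^ (-r)) * ENNReal.ofReal (2 * ρ) +
        ENNReal.ofReal (c ^ (-r) * (2 * δ ^ 2 / c) ^ 2) * ENNReal.ofReal 1 := by gcongr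
      _ = ENNReal.ofReal (K2 * ρ) := by
        rw [← ENNReal.ofReal_mul (by positivity), ← ENNReal.ofReal_mul (by positivity),
          ← ENNReal.ofReal_add (by positivity) (by positivity)]
        congr 1
        rw [hK2, hρ]
        field_simp
        ring
      _ ≤ _ := le_rfl
  · rintro f ⟨R, φ, hoc, hRX, hR1, hcv, hφ, hsub, hf, hf0⟩
    rcases R.eq_empty_or_nonempty with hRe | hRn
    · refine ⟨(⟨0, by omega⟩, ⟨0, by omega⟩, (⟨0, by simp⟩, ⟨0, by simp⟩,
        fun _ => ⟨0, by simp⟩)), fun x => ?_⟩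
      have hfx : f x = 0 := hf0 x (by simp [hRe])
      dsimp only
      rw [hfx]
      constructor
      · rw [if_neg]
        simp only [a, b, Set.mem_Ioo, not_and, not_lt]
        intro h; simp at h ⊢; linarith
      · have := hW0 (⟨0, by omega⟩, ⟨0, by omega⟩, (⟨0, by simp⟩, ⟨0, by simp⟩,
          fun _ => ⟨0, by simp⟩)) x
        split_ifs
        · positivity
        · exact le_rfl
    · have hbb : BddBelow R := ⟨0, fun x hx => (hRX x hx).1⟩
      have hba : BddAbove R := ⟨X, fun x hx => (hRX x hx).2⟩
      set A0 := sInf R with hA0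
      set B0 := sSup R with hB0
      have hA0n : 0 ≤ A0 := le_csInf hRn fun x hx => (hRX x hx).1
      have hB0X : B0 ≤ X := csSup_le hRn fun x hx => (hRX x hx).2
      have hAB : A0 ≤ B0 := csInf_le_csSup hRn hbb hba
      have hBA : B0 ≤ A0 + 1 := by
        apply csSup_le hRn
        intro y hy
        have : y - 1 ≤ A0 := le_csInf hRn fun x hx => by linarith [hR1 x hx y hy]
        linarith
      set α := ⌊A0 / ρ⌋₊ with hα
      set β := ⌊B0 / ρ⌋₊ with hβ
      have hαβ : α ≤ β := Nat.floor_mono (by gcongr)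
      have hα1 : (α : ℝ) ≤ A0 / ρ := Nat.floor_le (by positivity)
      have hα2 : A0 / ρ < α + 1 := Nat.lt_floor_add_one _
      have hβ1 : (β : ℝ) ≤ B0 / ρ := Nat.floor_le (div_nonneg (hA0n.trans hAB) hρ0.le)
      have hβ2 : B0 / ρ < β + 1 := Nat.lt_floor_add_one _
      have hαn : α < n1 + 1 := Nat.lt_succ_of_le (Nat.floor_mono (by gcongr; linarith))
      have hdn : β - α < n2 + 2 := by
        have h8 : B0 / ρ ≤ A0 / ρ + 1 / ρ := by rw [← add_div]; gcongr
        have h9 : 1 / ρ < n2 + 1 := Nat.lt_floor_add_one _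
        have : (β : ℝ) < α + (n2 + 2) := by linarith
        have : β < α + (n2 + 2) := by exact_mod_cast this
        omega
      rw [le_div_iff₀ hρ0] at hα1 hβ1
      rw [div_lt_iff₀ hρ0] at hα2 hβ2
      obtain ⟨w, hw⟩ := code_exists (a := ρ * (α : ℕ)) (T := T) (n := n) hRn
        (fun x hx => hc.le.trans (hφ x hx).1) (fun x hx => (hφ x hx).2) hcv
        (fun x hx => by
          have e1 : A0 ≤ x := csInf_le hbb hx
          have e2 : x ≤ B0 := le_csSup hba hx
          constructor
          · linarith
          · linarith) hL hδ hδ1 hsub (Nat.le_ceil _) (by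
            have := Nat.le_ceil (H / δ ^ 2)
            rw [hT]; push_cast; linarith)
      have hbb' : b (⟨α, hαn⟩, ⟨β - α, hdn⟩, w) = ρ * β := by
        simp only [b]
        rw [Nat.cast_sub hαβ]
        ring
      refine ⟨(⟨α, hαn⟩, ⟨β - α, hdn⟩, w), fun x => ?_⟩
      dsimp only
      rw [hbb']
      have haa : a (⟨α, hαn⟩, ⟨β - α, hdn⟩, w) = ρ * α := rfl
      rw [haa]
      by_cases hx : x ∈ R
      · have e1 : A0 ≤ x := csInf_le hbb hx
        have e2 : x ≤ B0 := le_csSup hba hx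
        have hx1 : x ∈ Set.Icc (ρ * α) (ρ * β + ρ) := ⟨by linarith, by linarith⟩
        rw [if_pos hx1, hf x hx]
        have hpos := hc.trans_le (hφ x hx).1
        constructor
        · split_ifs
          · apply Real.rpow_le_rpow_of_nonpos hpos _ (by linarith)
            have : φ x ≤ AA L δ (ρ * α) n w.seq x + 2 * δ ^ 2 := (hw x hx).2
            refine this.trans ?_
            gcongr
            exact le_max_left _ _
          · positivity
        · apply Real.rpow_le_rpow_of_nonpos (hW0 _ _) _ (by linarith)
          exact max_le (hw x hx).1 (hφ x hx).1
      · rw [hf0 x hx]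
        constructor
        · rw [if_neg]
          rintro ⟨g1, g2⟩
          obtain ⟨y, hy, hyx⟩ := exists_lt_of_csInf_lt hRn (show sInf R < x by linarith)
          obtain ⟨z, hz, hzx⟩ := exists_lt_of_lt_csSup hRn (show x < sSup R by linarith)
          exact hx (hoc.out hy hz ⟨hyx.le, hzx.le⟩)
        · have := hW0 (⟨α, hαn⟩, ⟨β - α, hdn⟩, w) x
          split_ifs
          · positivity
          · exact le_rfl
open MeasureTheory
open scoped ENNReal

lemma br_env {r c V T : ℝ} (hr : 1 < r) (hc : 0 < c) (hV : 0 ≤ V) (hT : 0 < T) :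
    Br {f | (∀ x, 0 ≤ f x) ∧ (∀ x, x ≤ 0 → f x = 0) ∧ (∀ x, f x ≤ V) ∧
      ∀ x, 0 < x → f x ≤ (c * x) ^ (-r)} (V * T + c ^ (-r) * (T ^ (1 - r) / (r - 1))) 0 := by
  classical
  have hr1 : 0 < r - 1 := by linarith
  refine ⟨Unit, inferInstance, fun _ _ => 0,
    fun _ x => if x ≤ 0 then 0 else if x ≤ T then V else (c * x) ^ (-r),
    fun _ x => (Set.Ioc 0 T).indicator (fun _ => ENNReal.ofReal V) x +
      (Set.Ioi T).indicator (fun x => ENNReal.ofReal (c ^ (-r) * x ^ (-r))) x, by simp, ?_, ?_, ?_,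
      ?_, ?_, ?_⟩
  · intro i
    exact (measurable_const.indicator measurableSet_Ioc).add
      ((by fun_prop : Measurable fun x : ℝ => ENNReal.ofReal (c ^ (-r) * x ^ (-r))).indicator
        measurableSet_Ioi)
  · intro i x; exact le_rfl
  · intro i x
    dsimp only
    split_ifs with h1 h2
    · exact le_rfl
    · exact hV
    · have : 0 < x := not_le.1 h1
      positivity
  · intro i x
    dsimp only
    split_ifs with h1 h2
    · simp
    · rw [Set.indicator_of_mem (show x ∈ Set.Ioc 0 T from ⟨not_le.1 h1, h2⟩), Real.sqrt_zero,
        sub_zero, Real.sq_sqrt hV]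
      exact le_self_add
    · have hx : 0 < x := not_le.1 h1
      rw [Set.indicator_of_mem (show x ∈ Set.Ioi T from not_le.1 h2), Real.sqrt_zero,
        sub_zero, Real.sq_sqrt (by positivity), Real.mul_rpow hc.le hx.le]
      exact le_add_self
  · intro i
    dsimp only
    rw [lintegral_add_left (measurable_const.indicator measurableSet_Ioc),
      lintegral_indicator measurableSet_Ioc, lintegral_indicator measurableSet_Ioi,
      setLIntegral_const, Real.volume_Ioc, sub_zero, ← ENNReal.ofReal_mul hV]
    have hIntg : IntegrableOn (fun x : ℝ => c ^ (-r) * x ^ (-r)) (Set.Ioi T) :=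
      (integrableOn_Ioi_rpow_of_lt (by linarith) hT).const_mul _
    rw [← ofReal_integral_eq_lintegral_ofReal hIntg]
    · rw [integral_const_mul, integral_Ioi_rpow_of_lt (by linarith) hT,
        ← ENNReal.ofReal_add (by positivity)]
      · apply ENNReal.ofReal_le_ofReal
        apply le_of_eq
        have e1 : -r + 1 = -(r - 1) := by ring
        have e2 : (1 : ℝ) - r = -(r - 1) := by ring
        rw [e1, e2, neg_div_neg_eq]
      · have e1 : -r + 1 = -(r - 1) := by ring
        rw [e1, neg_div_neg_eq]
        positivity
    · refine (ae_restrict_iff' measurableSet_Ioi).2 (Filter.Eventually.of_forall fun x hx => ?_)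
      have : 0 < x := hT.trans hx
      simp only [Pi.zero_apply]
      positivity
  · rintro f ⟨h0, h1, h2, h3⟩
    refine ⟨(), fun x => ⟨h0 x, ?_⟩⟩
    dsimp only
    split_ifs with g1 g2
    · exact (h1 x g1).le
    · exact h2 x
    · exact h3 x (not_le.1 g1)

lemma br_loc {V X d : ℝ} (hV : 0 ≤ V) (hX : 0 ≤ X) (hd : 0 < d) :
    Br {f | (∀ x, 0 ≤ f x ∧ f x ≤ V) ∧ ∃ S : Set ℝ, (∀ x ∈ S, 0 ≤ x ∧ x ≤ X) ∧
      (∀ x ∈ S, ∀ y ∈ S, y - x ≤ d) ∧ ∀ x, x ∉ S → f x = 0} (2 * d * V)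
      (Real.log (X / d + 1)) := by
  classical
  have hXd : 0 ≤ X / d := by positivity
  refine ⟨Fin (⌊X / d⌋₊ + 1), inferInstance, fun _ _ => 0,
    fun i x => if x ∈ Set.Icc (d * (i : ℕ)) (d * ((i : ℕ) + 2)) then V else 0,
    fun i x => (Set.Icc (d * ((i : ℕ) : ℝ)) (d * ((i : ℕ) + 2))).indicator
      (fun _ => ENNReal.ofReal V) x, ?_, ?_, ?_, ?_, ?_, ?_, ?_⟩
  · rw [Real.exp_log (by linarith), Fintype.card_fin]
    push_cast
    linarith [Nat.floor_le hXd]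
  · intro i; exact measurable_const.indicator measurableSet_Icc
  · intro i x; exact le_rfl
  · intro i x
    dsimp only
    split_ifs
    · exact hV
    · exact le_rfl
  · intro i x
    dsimp only
    split_ifs with h
    · rw [Set.indicator_of_mem h, Real.sqrt_zero, sub_zero, Real.sq_sqrt hV]
    · simp
  · intro i
    rw [lintegral_indicator measurableSet_Icc, setLIntegral_const, Real.volume_Icc,
      ← ENNReal.ofReal_mul hV]
    apply ENNReal.ofReal_le_ofReal
    apply le_of_eq
    ring
  · rintro f ⟨hf, S, h1, h2, h3⟩
    rcases S.eq_empty_or_nonempty with hS | hS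
    · refine ⟨⟨0, by omega⟩, fun x => ⟨(hf x).1, ?_⟩⟩
      rw [h3 x (by simp [hS])]
      dsimp only
      split_ifs
      · exact hV
      · exact le_rfl
    · have hbb : BddBelow S := ⟨0, fun x hx => (h1 x hx).1⟩
      have hn : 0 ≤ sInf S := le_csInf hS fun x hx => (h1 x hx).1
      have hX' : sInf S ≤ X := by
        obtain ⟨x, hx⟩ := hS
        exact (csInf_le hbb hx).trans (h1 x hx).2
      have e1 := Nat.floor_le (a := sInf S / d) (by positivity)
      have e2 := Nat.lt_floor_add_one (sInf S / d)
      rw [le_div_iff₀ hd] at e1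
      rw [div_lt_iff₀ hd] at e2
      refine ⟨⟨⌊sInf S / d⌋₊, Nat.lt_succ_of_le (Nat.floor_mono (by gcongr))⟩,
        fun x => ⟨(hf x).1, ?_⟩⟩
      dsimp only
      split_ifs with h
      · exact (hf x).2
      · apply le_of_eq
        apply h3
        intro hx
        apply h
        have e3 : sInf S ≤ x := csInf_le hbb hx
        have e4 : x - d ≤ sInf S := le_csInf hS fun y hy => by linarith [h2 y hy x hx]
        constructor <;> nlinarith

lemma subgrad {D : Set ℝ} {φ : ℝ → ℝ} (h : ConvexOn ℝ D φ) {x z : ℝ} (hx : x ∈ interior D)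
    (hz : z ∈ D) : φ x + derivWithin φ (Set.Ioi x) x * (z - x) ≤ φ z := by
  rcases lt_trichotomy x z with h1 | h1 | h1
  · have := h.rightDeriv_le_slope_of_mem_interior hx hz h1
    rw [slope_def_field, le_div_iff₀ (by linarith)] at this
    linarith
  · subst h1; simp
  · have h2 := h.slope_le_leftDeriv_of_mem_interior hz hx h1
    have h3 := h.leftDeriv_le_rightDeriv_of_mem_interior hx
    have h4 := h2.trans h3
    rw [slope_def_field, div_le_iff₀ (by linarith)] at h4
    linarith

noncomputable def lv (B v : ℝ) : ℕ := sInf {j : ℕ | v ≤ B * 2 ^ j}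

lemma lv_le_iff {B v : ℝ} {j : ℕ} (hB : 0 < B) : lv B v ≤ j ↔ v ≤ B * 2 ^ j := by
  constructor
  · intro h
    have hne : {j : ℕ | v ≤ B * 2 ^ j}.Nonempty := by
      obtain ⟨k, hk⟩ := pow_unbounded_of_one_lt (v / B) (one_lt_two : (1 : ℝ) < 2)
      refine ⟨k, ?_⟩
      rw [div_lt_iff₀ hB] at hk
      show v ≤ B * 2 ^ k
      linarith
    have h1 : v ≤ B * 2 ^ (lv B v) := Nat.sInf_mem hne
    refine h1.trans ?_
    gcongr
    norm_num
  · intro h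
    exact Nat.sInf_le h

lemma lv_mono {B v w : ℝ} (hB : 0 < B) (h : v ≤ w) : lv B v ≤ lv B w :=
  (lv_le_iff hB).2 (h.trans ((lv_le_iff hB).1 le_rfl))

lemma piece_mem {r c L X y w : ℝ} {R : Set ℝ} {φ f : ℝ → ℝ} (hy : 0 < y) (hw : 0 < w)
    (hc : 0 < c)
    (hoc : R.OrdConnected) (hX : ∀ x ∈ R, 0 ≤ x ∧ x ≤ w * X) (hd : ∀ x ∈ R, ∀ z ∈ R, z - x ≤ w)
    (hcv : ConvexOn ℝ R φ) (hφ : ∀ x ∈ R, c * y ≤ φ x ∧ φ x ≤ y)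
    (hs : ∀ x ∈ R, ∃ m, |m| * w ≤ L * y ∧ ∀ z ∈ R, φ x + m * (z - x) ≤ φ z)
    (hf : ∀ x ∈ R, f x = φ x ^ (-r)) (hf0 : ∀ x, x ∉ R → f x = 0) :
    f ∈ {f | ∃ f' ∈ PC r c L X, ∀ x, f x = y ^ (-r) * f' (x / w)} := by
  classical
  refine ⟨fun z => if w * z ∈ R then (φ (w * z) / y) ^ (-r) else 0,
    ⟨{z | w * z ∈ R}, fun z => φ (w * z) / y, ?_, ?_, ?_, ⟨?_, ?_⟩, ?_, ?_, ?_, ?_⟩, ?_⟩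
  · refine ⟨fun a ha b hb z hz => ?_⟩
    exact hoc.out ha hb ⟨by gcongr; exact hz.1, by gcongr; exact hz.2⟩
  · intro z hz
    obtain ⟨h1, h2⟩ := hX _ hz
    exact ⟨(mul_nonneg_iff_of_pos_left hw).1 h1, le_of_mul_le_mul_left h2 hw⟩
  · intro x hx z hz
    have := hd _ hx _ hz
    rw [← mul_sub] at this
    exact le_of_mul_le_mul_left (by linarith) hw
  · intro a ha b hb s t hs ht hst
    have := hcv.1 ha hb hs ht hst
    simp only [smul_eq_mul, Set.mem_ofPred_eq] at this ⊢
    convert this using 1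
    ring
  · intro a ha b hb s t hs ht hst
    have := hcv.2 ha hb hs ht hst
    simp only [smul_eq_mul] at this ⊢
    have e : w * (s * a + t * b) = s * (w * a) + t * (w * b) := by ring
    rw [e, div_le_iff₀ hy]
    refine this.trans (le_of_eq ?_)
    field_simp
  · intro z hz
    obtain ⟨h1, h2⟩ := hφ _ hz
    exact ⟨by rw [le_div_iff₀ hy]; exact h1, by rw [div_le_one hy]; exact h2⟩
  · intro x hx
    obtain ⟨m, h1, h2⟩ := hs _ hx
    refine ⟨m * w / y, ?_, fun z hz => ?_⟩
    · rw [abs_div, abs_mul, abs_of_pos hw, abs_of_pos hy, div_le_iff₀ hy]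
      exact h1
    · have := h2 _ hz
      have e : φ (w * x) / y + m * w / y * (z - x) = (φ (w * x) + m * (w * z - w * x)) / y := by
        ring
      rw [e]
      exact div_le_div_of_nonneg_right this hy.le
  · intro x hx
    exact if_pos hx
  · intro x hx
    exact if_neg hx
  · intro x
    have e : w * (x / w) = x := by field_simp
    simp only [e]
    split_ifs with h
    · have h1 := (hφ x h).1
      have h2 : 0 < φ x := lt_of_lt_of_le (by positivity) h1
      rw [hf x h, Real.div_rpow h2.le hy.le]
      have := (Real.rpow_pos_of_pos hy (-r)).ne'
      field_simp
    · rw [hf0 x h]; simp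

lemma geom_bound {ω : ℝ} (h0 : 0 < ω) (h1 : ω < 1) (n : ℕ) :
    ∑ k ∈ Finset.range n, ω ^ k ≤ (1 - ω)⁻¹ := by
  rw [← tsum_geometric_of_lt_one h0.le h1]
  exact (summable_geometric_of_lt_one h0.le h1).sum_le_tsum _ (fun i _ => by positivity)

lemma exists_n {ω : ℝ} (h0 : 0 < ω) (h1 : ω < 1) : ∃ C, 0 < C ∧ ∀ ε : ℝ, 0 < ε → ε ≤ 1 →
    ∃ n : ℕ, ω ^ (8 * n) ≤ ε ^ 2 ∧ ((n : ℝ) + 1) ^ 3 ≤ C * ε ^ (-(1 : ℝ) / 2) := by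
  set β := -Real.log ω with hβ
  have hβ0 : 0 < β := by rw [hβ]; linarith [Real.log_neg h0 h1]
  refine ⟨(12 / (8 * β) + 2) ^ 3, by positivity, fun ε hε hε1 => ?_⟩
  set t := ε ^ (-(1 : ℝ) / 6) with ht
  have ht0 : 0 < t := Real.rpow_pos_of_pos hε _
  have ht1 : 1 ≤ t := Real.one_le_rpow_of_pos_of_le_one_of_nonpos hε hε1 (by norm_num)
  have e1 : t ^ 3 = ε ^ (-(1 : ℝ) / 2) := by
    rw [ht, ← Real.rpow_natCast, ← Real.rpow_mul hε.le]; norm_num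
  have e2 : t ^ 12 * ε ^ 2 = 1 := by
    rw [ht, ← Real.rpow_natCast, ← Real.rpow_mul hε.le, ← Real.rpow_natCast ε 2,
      ← Real.rpow_add hε]
    norm_num
  refine ⟨⌈12 / (8 * β) * t⌉₊, ?_, ?_⟩
  · have h2 : 12 / (8 * β) * t ≤ ⌈12 / (8 * β) * t⌉₊ := Nat.le_ceil _
    have h3 : ω = Real.exp (-β) := by rw [hβ, neg_neg, Real.exp_log h0]
    have h4 : t ^ 12 ≤ Real.exp (12 * t) := by
      have : t ≤ Real.exp t := by linarith [Real.add_one_le_exp t]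
      calc t ^ 12 ≤ Real.exp t ^ 12 := by gcongr
        _ = _ := by rw [← Real.exp_nat_mul]; norm_num
    have h5 : ω ^ (8 * ⌈12 / (8 * β) * t⌉₊) ≤ Real.exp (-(12 * t)) := by
      rw [h3, ← Real.exp_nat_mul, Real.exp_le_exp]
      push_cast
      have : 12 * t = 8 * β * (12 / (8 * β) * t) := by field_simp
      rw [this]
      nlinarith
    refine h5.trans ?_
    rw [Real.exp_neg, inv_le_iff_one_le_mul₀ (Real.exp_pos _), ← e2]
    rw [mul_comm]
    gcongr
  · rw [← e1, ← mul_pow]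
    have := Nat.ceil_lt_add_one (a := 12 / (8 * β) * t) (by positivity)
    gcongr
    nlinarith
open MeasureTheory
open scoped ENNReal

def HD (r c m B : ℝ) (D : Set ℝ) (φ f : ℝ → ℝ) : Prop :=
  ConvexOn ℝ D φ ∧ (-1) ∈ D ∧ 0 ∈ D ∧ (∀ x ∈ D, m ≤ φ x ∧ c * x ≤ φ x) ∧ φ 0 ≤ B ∧ φ (-1) ≤ B ∧
    (∀ x, x ∈ D → 0 < x → f x = φ x ^ (-r)) ∧ (∀ x, ¬ (x ∈ D ∧ 0 < x) → f x = 0)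

def HC (r c m B : ℝ) : Set (ℝ → ℝ) := {f | ∃ D φ, HD r c m B D φ f}

def RR (B : ℝ) (D : Set ℝ) (φ : ℝ → ℝ) (k j : ℕ) : Set ℝ :=
  {x | 0 < x ∧ x ∈ interior D ∧ lv B (φ x) = k ∧ lv B (derivWithin φ (Set.Ioi x) x) = j}

lemma lv_succ_lt {B v : ℝ} {j : ℕ} (hB : 0 < B) (h : lv B v = j + 1) : B * 2 ^ j < v := by
  by_contra hh
  have := (lv_le_iff hB).2 (not_lt.1 hh)
  omega

lemma le_of_lv {B v : ℝ} {j : ℕ} (hB : 0 < B) (h : lv B v = j) : v ≤ B * 2 ^ j :=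
  (lv_le_iff hB).1 h.le

lemma RR_oc {r c m B : ℝ} {D : Set ℝ} {φ f : ℝ → ℝ} (hB : 0 < B)
    (h : HD r c m B D φ f) (k j : ℕ) : (RR B D φ k j).OrdConnected := by
  obtain ⟨hcv, hm1, h0, hm, hB0, hB1, hf, hf0⟩ := h
  refine ⟨fun x hx y hy z hz => ?_⟩
  obtain ⟨x1, x2, x3, x4⟩ := hx
  obtain ⟨y1, y2, y3, y4⟩ := hy
  have hzi : z ∈ interior D := hcv.1.interior.ordConnected.out x2 y2 hz
  have hz0 : 0 < z := x1.trans_le hz.1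
  refine ⟨hz0, hzi, ?_, ?_⟩
  · apply le_antisymm
    · have := hcv.le_max_of_mem_Icc (interior_subset x2) (interior_subset y2) hz
      rcases le_max_iff.1 this with g | g
      · rw [← x3]; exact lv_mono hB g
      · rw [← y3]; exact lv_mono hB g
    · rcases Nat.eq_zero_or_pos k with hk | hk
      · omega
      · obtain ⟨k', rfl⟩ : ∃ k', k = k' + 1 := ⟨k - 1, by omega⟩
        have g1 := lv_succ_lt hB x3
        have g2 : B ≤ B * 2 ^ k' := le_mul_of_one_le_right hB.le (one_le_pow₀ (by norm_num))
        have := hcv.le_max_of_mem_Icc h0 (interior_subset hzi) ⟨x1.le, hz.1⟩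
        rcases le_max_iff.1 this with g | g
        · linarith
        · rw [← x3]; exact lv_mono hB g
  · have mo := hcv.monotoneOn_rightDeriv
    apply le_antisymm
    · rw [← y4]; exact lv_mono hB (mo hzi y2 hz.2)
    · rw [← x4]; exact lv_mono hB (mo x2 hzi hz.1)

lemma deriv_ge {r c m B : ℝ} {D : Set ℝ} {φ f : ℝ → ℝ} (hm0 : 0 < m)
    (h : HD r c m B D φ f) {x : ℝ} (hx0 : 0 < x) (hx : x ∈ interior D) :
    -B ≤ derivWithin φ (Set.Ioi x) x := by
  obtain ⟨hcv, hm1, h0, hm, hB0, hB1, hf, hf0⟩ := h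
  have h1 := subgrad hcv hx hm1
  have h2 := (hm x (interior_subset hx)).1
  have h3 := (hm _ h0).1
  by_contra hh
  push Not at hh
  nlinarith

open Classical in
lemma hc_piece {r c m B : ℝ} {D : Set ℝ} {φ f : ℝ → ℝ} (hc : 0 < c) (hm0 : 0 < m) (hB : 0 < B)
    (h : HD r c m B D φ f) (k j : ℕ) :
    (fun x => if x ∈ RR B D φ k j then f x else 0) ∈
      {g | ∃ f' ∈ PC r (min (m / B) (1 / 2)) (max 2 (B / c)) (2 ^ j),
        ∀ x, g x = (B * 2 ^ k) ^ (-r) * f' (x / (max 2 (B / c) * 2 ^ k / 2 ^ j))} := by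
  have h' := h
  obtain ⟨hcv, hm1, h0, hm, hB0, hB1, hf, hf0⟩ := h
  set C2 := max 2 (B / c) with hC2
  have hC20 : 2 ≤ C2 := le_max_left _ _
  have hC21 : B / c ≤ C2 := le_max_right _ _
  have hx2 : ∀ x ∈ RR B D φ k j, x ≤ B / c * 2 ^ k := by
    rintro x ⟨x1, x2, x3, x4⟩
    have := (hm x (interior_subset x2)).2
    have g := le_of_lv hB x3
    rw [div_mul_eq_mul_div, le_div_iff₀ hc]; linarith
  have hsub : RR B D φ k j ⊆ D := fun x hx => interior_subset hx.2.1
  refine piece_mem (φ := φ) (R := RR B D φ k j) (by positivity) (by positivity) (by positivity)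
    (RR_oc hB h' k j) ?_ ?_ ?_ ?_ ?_ ?_ ?_
  · intro x hx
    refine ⟨hx.1.le, (hx2 x hx).trans ?_⟩
    rw [div_mul_cancel₀ _ (by positivity)]
    gcongr
  · intro x hx z hz
    rcases Nat.eq_zero_or_pos j with hj | hj
    · subst hj
      have g1 := hx2 z hz
      have g2 := hx.1
      have : B / c * 2 ^ k ≤ C2 * 2 ^ k := by gcongr
      simp only [pow_zero, div_one]
      linarith
    · obtain ⟨j', rfl⟩ : ∃ j', j = j' + 1 := ⟨j - 1, by omega⟩
      have g1 := lv_succ_lt hB hx.2.2.2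
      have g2 := subgrad hcv hx.2.1 (hsub hz)
      have g3 := le_of_lv hB hz.2.2.1
      have g4 := (hm x (hsub hx)).1
      rcases le_total (z - x) 0 with g | g
      · exact g.trans (by positivity)
      · have g5 : B * 2 ^ j' * (z - x) ≤ B * 2 ^ k :=
          (mul_le_mul_of_nonneg_right g1.le g).trans (by linarith)
        have g6 : 2 ^ j' * (z - x) ≤ 2 ^ k := by
          rw [mul_assoc] at g5; exact le_of_mul_le_mul_left g5 hB
        rw [le_div_iff₀ (by positivity), pow_succ]
        have g7 : (2 : ℝ) * 2 ^ k ≤ C2 * 2 ^ k := by gcongr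
        linarith
  · exact hcv.subset hsub ((RR_oc hB h' k j).convex)
  · intro x hx
    have g1 := le_of_lv hB hx.2.2.1
    refine ⟨?_, g1⟩
    rcases Nat.eq_zero_or_pos k with hk | hk
    · subst hk
      refine le_trans ?_ (hm x (hsub hx)).1
      calc _ ≤ m / B * (B * 2 ^ 0) := by gcongr; exact min_le_left _ _
        _ = m := by field_simp
    · obtain ⟨k', rfl⟩ : ∃ k', k = k' + 1 := ⟨k - 1, by omega⟩
      have g1 := lv_succ_lt hB hx.2.2.1
      calc _ ≤ 1 / 2 * (B * 2 ^ (k' + 1)) := by gcongr; exact min_le_right _ _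
        _ = B * 2 ^ k' := by ring
        _ ≤ _ := g1.le
  · intro x hx
    refine ⟨derivWithin φ (Set.Ioi x) x, ?_, fun z hz => subgrad hcv hx.2.1 (hsub hz)⟩
    have g1 := le_of_lv hB hx.2.2.2
    have g2 := deriv_ge hm0 h' hx.1 hx.2.1
    have g3 : B ≤ B * 2 ^ j := le_mul_of_one_le_right hB.le (one_le_pow₀ (by norm_num))
    have g4 : |derivWithin φ (Set.Ioi x) x| ≤ B * 2 ^ j := abs_le.2 ⟨by linarith, g1⟩
    calc _ ≤ B * 2 ^ j * (C2 * 2 ^ k / 2 ^ j) := by gcongr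
      _ = _ := by field_simp
  · intro x hx
    simp only [hx, if_true]
    exact hf x (hsub hx) hx.1
  · intro x hx
    simp only [hx, if_false]
open MeasureTheory
open scoped ENNReal

open Classical in
lemma hc_rest1 {r c m B : ℝ} {D : Set ℝ} {φ f : ℝ → ℝ} (hr : 1 < r) (hc : 0 < c) (hm0 : 0 < m)
    (hB : 0 < B) (h : HD r c m B D φ f) (n : ℕ) :
    (fun x => if n < lv B (φ x) then f x else 0) ∈
      {f | (∀ x, 0 ≤ f x) ∧ (∀ x, x ≤ 0 → f x = 0) ∧ (∀ x, f x ≤ (B * 2 ^ n) ^ (-r)) ∧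
      ∀ x, 0 < x → f x ≤ (c * x) ^ (-r)} := by
  obtain ⟨hcv, hm1, h0, hm, hB0, hB1, hf, hf0⟩ := h
  have key : ∀ x, (fun x => if n < lv B (φ x) then f x else 0) x = 0 ∨
      (x ∈ D ∧ 0 < x ∧ B * 2 ^ n < φ x ∧
        (fun x => if n < lv B (φ x) then f x else 0) x = φ x ^ (-r)) := by
    intro x
    dsimp only
    split_ifs with g
    · by_cases hx : x ∈ D ∧ 0 < x
      · refine Or.inr ⟨hx.1, hx.2, ?_, hf x hx.1 hx.2⟩
        by_contra hh
        have := (lv_le_iff hB).2 (not_lt.1 hh)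
        omega
      · exact Or.inl (hf0 x hx)
    · exact Or.inl rfl
  refine ⟨fun x => ?_, fun x hx => ?_, fun x => ?_, fun x hx => ?_⟩ <;>
    rcases key x with g | ⟨g1, g2, g3, g4⟩
  · exact g.ge
  · rw [g4]
    have := hm0.trans_le (hm x g1).1
    positivity
  · exact g
  · linarith
  · rw [g]; positivity
  · rw [g4]
    exact Real.rpow_le_rpow_of_nonpos (by positivity) g3.le (by linarith)
  · rw [g]; positivity
  · rw [g4]
    exact Real.rpow_le_rpow_of_nonpos (by positivity) (hm x g1).2 (by linarith)

open Classical in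
lemma hc_rest2 {r c m B : ℝ} {D : Set ℝ} {φ f : ℝ → ℝ} (hr : 1 < r) (hc : 0 < c) (hm0 : 0 < m)
    (hB : 0 < B) (h : HD r c m B D φ f) (n : ℕ) :
    (fun x => if lv B (φ x) ≤ n ∧
        ¬ (x ∈ interior D ∧ lv B (derivWithin φ (Set.Ioi x) x) ≤ 2 * n) then f x else 0) ∈
      {f | (∀ x, 0 ≤ f x ∧ f x ≤ m ^ (-r)) ∧ ∃ S : Set ℝ, (∀ x ∈ S, 0 ≤ x ∧ x ≤ B * 2 ^ n / c) ∧
      (∀ x ∈ S, ∀ y ∈ S, y - x ≤ 1 / 2 ^ n) ∧ ∀ x, x ∉ S → f x = 0} := by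
  obtain ⟨hcv, hm1, h0, hm, hB0, hB1, hf, hf0⟩ := h
  refine ⟨fun x => ?_, {x | x ∈ D ∧ 0 < x ∧ lv B (φ x) ≤ n ∧
        ¬ (x ∈ interior D ∧ lv B (derivWithin φ (Set.Ioi x) x) ≤ 2 * n)}, ?_, ?_, ?_⟩
  · have p1 : 0 ≤ m ^ (-r) := by positivity
    dsimp only
    split_ifs with g
    · by_cases hx : x ∈ D ∧ 0 < x
      · rw [hf x hx.1 hx.2]
        have g1 := (hm x hx.1).1
        have g2 := hm0.trans_le g1
        exact ⟨by positivity, Real.rpow_le_rpow_of_nonpos hm0 g1 (by linarith)⟩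
      · rw [hf0 x hx]; exact ⟨le_rfl, p1⟩
    · exact ⟨le_rfl, p1⟩
  · rintro x ⟨x1, x2, x3, x4⟩
    refine ⟨x2.le, ?_⟩
    rw [le_div_iff₀ hc]
    have g1 := (hm x x1).2
    have g2 := (lv_le_iff hB).1 x3
    linarith
  · rintro x ⟨x1, x2, x3, x4⟩ y ⟨y1, y2, y3, y4⟩
    rcases le_or_gt y x with hyx | hyx
    · exact (sub_nonpos.2 hyx).trans (by positivity)
    have hi : x ∈ interior D := by
      have s1 : Set.Icc (-1) y ⊆ D := hcv.1.ordConnected.out hm1 y1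
      have s2 : Set.Ioo (-1) y ⊆ interior D :=
        interior_maximal (Set.Ioo_subset_Icc_self.trans s1) isOpen_Ioo
      exact s2 ⟨by linarith, hyx⟩
    have g0 : ¬ lv B (derivWithin φ (Set.Ioi x) x) ≤ 2 * n := fun hh => x4 ⟨hi, hh⟩
    rw [lv_le_iff hB, not_le] at g0
    have g2 := subgrad hcv hi y1
    have g3 := (lv_le_iff hB).1 y3
    have g4 := (hm x x1).1
    have g : 0 < y - x := sub_pos.2 hyx
    have g5 : B * 2 ^ (2 * n) * (y - x) ≤ B * 2 ^ n :=
      (mul_le_mul_of_nonneg_right g0.le g.le).trans (by linarith)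
    have g6 : (2 : ℝ) ^ n * (2 ^ n * (y - x)) ≤ 2 ^ n * 1 := by
      rw [mul_assoc] at g5
      have := le_of_mul_le_mul_left g5 hB
      rw [two_mul, pow_add] at this
      linarith
    have g7 := le_of_mul_le_mul_left g6 (by positivity)
    rw [le_div_iff₀ (by positivity)]
    linarith
  · intro x hx
    dsimp only
    split_ifs with g
    · apply hf0
      rintro ⟨q1, q2⟩
      exact hx ⟨q1, q2, g.1, g.2⟩
    · rfl

open Classical in
lemma hc_decomp {r c m B : ℝ} {D : Set ℝ} {φ f : ℝ → ℝ}
    (h : HD r c m B D φ f) (n : ℕ) (x : ℝ) :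
    f x = ((if n < lv B (φ x) then f x else 0) +
      (if lv B (φ x) ≤ n ∧
        ¬ (x ∈ interior D ∧ lv B (derivWithin φ (Set.Ioi x) x) ≤ 2 * n) then f x else 0)) +
      ∑ i ∈ Finset.range (n + 1) ×ˢ Finset.range (2 * n + 1),
        if x ∈ RR B D φ i.1 i.2 then f x else 0 := by
  obtain ⟨hcv, hm1, h0, hm, hB0, hB1, hf, hf0⟩ := h
  by_cases hx : x ∈ D ∧ 0 < x
  · by_cases h1 : n < lv B (φ x)
    · have h2 : ¬ lv B (φ x) ≤ n := by omega
      rw [if_pos h1, if_neg (by tauto), Finset.sum_eq_zero, add_zero, add_zero]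
      rintro ⟨k, j⟩ hi
      simp only [Finset.mem_product, Finset.mem_range] at hi
      apply if_neg
      rintro ⟨-, -, q, -⟩
      dsimp only at q
      omega
    · have h2 : lv B (φ x) ≤ n := by omega
      by_cases h3 : x ∈ interior D ∧ lv B (derivWithin φ (Set.Ioi x) x) ≤ 2 * n
      · rw [if_neg h1, if_neg (by tauto),
          Finset.sum_eq_single (lv B (φ x), lv B (derivWithin φ (Set.Ioi x) x)), if_pos]
        · ring
        · exact ⟨hx.2, h3.1, rfl, rfl⟩
        · rintro ⟨k, j⟩ _ hne
          apply if_neg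
          rintro ⟨-, -, q1, q2⟩
          exact hne (by rw [q1, q2])
        · intro hh
          exfalso
          apply hh
          simp only [Finset.mem_product, Finset.mem_range]
          omega
      · rw [if_neg h1, if_pos ⟨h2, h3⟩, Finset.sum_eq_zero]
        · ring
        · rintro ⟨k, j⟩ hi
          simp only [Finset.mem_product, Finset.mem_range] at hi
          apply if_neg
          rintro ⟨-, q1, -, q2⟩
          apply h3
          refine ⟨q1, ?_⟩
          dsimp only at q2
          omega
  · simp [hf0 x hx]
open MeasureTheory
open scoped ENNReal

lemma hc_cell {r B ω C2 K ε : ℝ} {F : ℝ → Set (ℝ → ℝ)} (hB : 0 < B)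
    (hω0 : 0 < ω) (hω1 : ω < 1) (hω8 : 1 / 2 ≤ ω ^ 8)
    (hω : ∀ k : ℕ, ((2 : ℝ) ^ k) ^ (-r) * 2 ^ k = ω ^ (8 * k)) (hC2 : 0 < C2) (hK : 0 < K)
    (hF : ∀ X δ, 0 ≤ X → 0 < δ → δ ≤ 1 → Br (F X) (K * δ ^ 4) (K / δ + Real.log (X + 1)))
    (hε : 0 < ε) (k j : ℕ) :
    Br {g | ∃ f' ∈ F (2 ^ j), ∀ x, g x = (B * 2 ^ k) ^ (-r) * f' (x / (C2 * 2 ^ k / 2 ^ j))}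
      (B ^ (-r) * C2 * K * ε ^ 2 * (ω ^ k * ω ^ j))
      (K * (1 + ω ^ k * ω ^ j * ε ^ (-(1 : ℝ) / 2)) + (j + 1)) := by
  set q := ω ^ k * ω ^ j with hq
  have hq0 : 0 < q := by positivity
  have hq1 : q ≤ 1 := mul_le_one₀ (pow_le_one₀ hω0.le hω1.le) (by positivity)
    (pow_le_one₀ hω0.le hω1.le)
  have hs : 0 < Real.sqrt ε := Real.sqrt_pos.2 hε
  have hse : ε ^ (-(1 : ℝ) / 2) = 1 / Real.sqrt ε := by
    rw [Real.sqrt_eq_rpow, one_div, ← Real.rpow_neg hε.le]; norm_num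
  have hs4 : Real.sqrt ε ^ 4 = ε ^ 2 := by
    have := Real.sq_sqrt hε.le
    calc Real.sqrt ε ^ 4 = (Real.sqrt ε ^ 2) ^ 2 := by ring
      _ = _ := by rw [this]
  set δ := min 1 (Real.sqrt ε / q) with hδ
  have hδ0 : 0 < δ := lt_min one_pos (by positivity)
  have hδ1 : δ ≤ 1 := min_le_left _ _
  have hδ2 : δ * q ≤ Real.sqrt ε := by
    rw [← le_div_iff₀ hq0]; exact min_le_right _ _
  refine ((hF (2 ^ j) δ (by positivity) hδ0 hδ1).scale (k := (B * 2 ^ k) ^ (-r))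
    (w := C2 * 2 ^ k / 2 ^ j) (by positivity) (by positivity)).mono subset_rfl ?_ ?_
  · have h2j : (1 : ℝ) / 2 ^ j ≤ ω ^ (8 * j) := by
      rw [pow_mul, ← one_div_pow]
      gcongr
    have h4 : (δ * q) ^ 4 ≤ ε ^ 2 := by rw [← hs4]; gcongr
    rw [Real.mul_rpow hB.le (by positivity)]
    calc B ^ (-r) * (2 ^ k) ^ (-r) * (C2 * 2 ^ k / 2 ^ j) * (K * δ ^ 4)
        = B ^ (-r) * C2 * K * δ ^ 4 * (((2 ^ k) ^ (-r) * 2 ^ k) * (1 / 2 ^ j)) := by ring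
      _ ≤ B ^ (-r) * C2 * K * δ ^ 4 * (ω ^ (8 * k) * ω ^ (8 * j)) := by
          rw [hω k]; gcongr
      _ = B ^ (-r) * C2 * K * ((δ * q) ^ 4 * (q ^ 3 * q)) := by rw [hq]; ring
      _ ≤ B ^ (-r) * C2 * K * (ε ^ 2 * (1 * q)) := by
          gcongr
          exact pow_le_one₀ hq0.le hq1
      _ = _ := by ring
  · have h1 : 1 / δ ≤ 1 + q * (1 / Real.sqrt ε) := by
      rcases min_choice 1 (Real.sqrt ε / q) with g | g
      · rw [hδ, g]
        have : 0 ≤ q * (1 / Real.sqrt ε) := by positivity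
        linarith
      · rw [hδ, g, one_div_div, mul_one_div]; linarith
    have h2 : Real.log (2 ^ j + 1) ≤ j + 1 := by
      rw [Real.log_le_iff_le_exp (by positivity)]
      have e1 : (2 : ℝ) ≤ Real.exp 1 := by linarith [Real.add_one_le_exp (1 : ℝ)]
      have e2 : (1 : ℝ) ≤ 2 ^ j := one_le_pow₀ (by norm_num)
      calc (2 : ℝ) ^ j + 1 ≤ 2 ^ (j + 1) := by rw [pow_succ]; linarith
        _ ≤ Real.exp 1 ^ (j + 1) := by gcongr
        _ = _ := by rw [← Real.exp_nat_mul]; push_cast; ring_nf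
    rw [hse]
    have : K / δ ≤ K * (1 + q * (1 / Real.sqrt ε)) := by
      rw [div_eq_mul_one_div]; gcongr
    linarith

lemma Br.add' {F₁ F₂ : Set (ℝ → ℝ)} {E₁ E₂ A₁ A₂ : ℝ} (h₁ : Br F₁ E₁ A₁) (h₂ : Br F₂ E₂ A₂)
    (hE₁ : 0 ≤ E₁) (hE₂ : 0 ≤ E₂) :
    Br {f | ∃ f₁ ∈ F₁, ∃ f₂ ∈ F₂, ∀ x, f x = f₁ x + f₂ x} (E₁ + E₂) (A₁ + A₂) :=
  Br.add h₁ h₂ hE₁ hE₂ fun _ hf => hf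

lemma half {r c m B : ℝ} (hr : 1 < r) (hr2 : r ≤ 2) (hc : 0 < c) (hm0 : 0 < m) (hB : 0 < B) :
    ∃ C K : ℝ, 0 < C ∧ 0 < K ∧ ∀ ε : ℝ, 0 < ε → ε ≤ 1 →
      Br (HC r c m B) (C * ε ^ 2) (K * ε ^ (-(1 : ℝ) / 2)) := by
  classical
  set ω : ℝ := 2 ^ ((1 - r) / 8) with hωd
  have hω0 : 0 < ω := by positivity
  have hω1 : ω < 1 := Real.rpow_lt_one_of_one_lt_of_neg (by norm_num) (by linarith)
  have hω8' : ω ^ 8 = 2 ^ (1 - r) := by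
    rw [hωd, ← Real.rpow_natCast, ← Real.rpow_mul (by norm_num)]; congr 1; push_cast; ring
  have hω8 : 1 / 2 ≤ ω ^ 8 := by
    rw [hω8']
    calc (1 / 2 : ℝ) = 2 ^ (-1 : ℝ) := by rw [Real.rpow_neg_one]; norm_num
      _ ≤ _ := Real.rpow_le_rpow_of_exponent_le (by norm_num) (by linarith)
  have hω' : ∀ k : ℕ, ((2 : ℝ) ^ k) ^ (1 - r) = ω ^ (8 * k) := by
    intro k
    rw [pow_mul, hω8', ← Real.rpow_natCast, ← Real.rpow_natCast, ← Real.rpow_mul (by norm_num),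
      ← Real.rpow_mul (by norm_num), mul_comm]
  have hω : ∀ k : ℕ, ((2 : ℝ) ^ k) ^ (-r) * 2 ^ k = ω ^ (8 * k) := by
    intro k
    rw [← hω', sub_eq_neg_add, Real.rpow_add (by positivity), Real.rpow_one]
  set C2 := max 2 (B / c) with hC2d
  have hC2 : 0 < C2 := lt_of_lt_of_le two_pos (le_max_left _ _)
  obtain ⟨K, hK, hpiece⟩ := piece (r := r) (c := min (m / B) (1 / 2)) (L := C2) (by linarith) hr2
    (by positivity) hC2.le
  obtain ⟨Cn, hCn, hn⟩ := exists_n hω0 hω1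
  set G := (1 - ω)⁻¹ with hG
  have hG0 : 0 < G := inv_pos.2 (by linarith)
  have hr1 : 0 < r - 1 := by linarith
  refine ⟨(B ^ (-r) + c ^ (-r) * (1 / (r - 1))) + 2 * m ^ (-r) + B ^ (-r) * C2 * K * (G * G),
    (B / c + 2) * Cn + (K * (2 * Cn) + K * (G * G) + 4 * Cn), by positivity, by positivity,
    fun ε hε hε1 => ?_⟩
  obtain ⟨n, hn1, hn2⟩ := hn ε hε hε1
  set e := ε ^ (-(1 : ℝ) / 2) with he
  have he0 : 0 < e := by positivity
  have b1 := br_env (V := (B * 2 ^ n) ^ (-r)) (T := 2 ^ n) hr hc (by positivity) (by positivity)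
  have b2 := br_loc (V := m ^ (-r)) (X := B * 2 ^ n / c) (d := 1 / 2 ^ n) (by positivity)
    (by positivity) (by positivity)
  have b3 := Br.sum (κ := ℕ × ℕ) (Finset.range (n + 1) ×ˢ Finset.range (2 * n + 1)) _ _ _
    (fun i _ => by positivity)
    (fun i _ => hc_cell hB hω0 hω1 hω8 hω hC2 hK hpiece hε i.1 i.2)
  have b12 := Br.add' b1 b2 (by positivity) (by positivity)
  have b := Br.add (F := HC r c m B) b12 b3 (by positivity)
    (Finset.sum_nonneg fun i _ => by positivity) (by
      rintro f ⟨D, φ, hf⟩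
      exact ⟨_, ⟨_, hc_rest1 hr hc hm0 hB hf n, _, hc_rest2 hr hc hm0 hB hf n, fun x => rfl⟩, _,
        ⟨_, fun i _ => hc_piece hc hm0 hB hf i.1 i.2, fun x => rfl⟩, hc_decomp hf n⟩)
  have h2n : (1 : ℝ) / 2 ^ n ≤ ω ^ (8 * n) := by
    rw [pow_mul, ← one_div_pow]
    gcongr
  have hsum : ∑ i ∈ Finset.range (n + 1) ×ˢ Finset.range (2 * n + 1), ω ^ i.1 * ω ^ i.2 ≤
      G * G := by
    rw [Finset.sum_product]
    simp only
    rw [← Finset.sum_mul_sum]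
    exact mul_le_mul (geom_bound hω0 hω1 _) (geom_bound hω0 hω1 _)
      (Finset.sum_nonneg fun i _ => by positivity) hG0.le
  have hn0 : (0 : ℝ) ≤ n := Nat.cast_nonneg n
  refine b.mono subset_rfl ?_ ?_
  · rw [← Finset.mul_sum, hω', Real.mul_rpow hB.le (by positivity)]
    have t1 : B ^ (-r) * (2 ^ n) ^ (-r) * 2 ^ n + c ^ (-r) * (ω ^ (8 * n) / (r - 1)) ≤
        (B ^ (-r) + c ^ (-r) * (1 / (r - 1))) * ε ^ 2 := by
      rw [mul_assoc, hω]
      calc _ = (B ^ (-r) + c ^ (-r) * (1 / (r - 1))) * ω ^ (8 * n) := by ring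
        _ ≤ _ := by gcongr
    have t2 : 2 * (1 / 2 ^ n) * m ^ (-r) ≤ 2 * m ^ (-r) * ε ^ 2 := by
      have := h2n.trans hn1
      calc _ = 2 * m ^ (-r) * (1 / 2 ^ n) := by ring
        _ ≤ _ := by gcongr
    have t3 : B ^ (-r) * C2 * K * ε ^ 2 *
        ∑ i ∈ Finset.range (n + 1) ×ˢ Finset.range (2 * n + 1), ω ^ i.1 * ω ^ i.2 ≤
        B ^ (-r) * C2 * K * ε ^ 2 * (G * G) := by gcongr
    linarith
  · have hbc : 0 < B / c := by positivity
    have n3 : ((n : ℝ) + 1) ≤ (n + 1) ^ 3 := le_self_pow₀ (by linarith) (by norm_num)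
    have t2 : Real.log (B * 2 ^ n / c / (1 / 2 ^ n) + 1) ≤ (B / c + 2) * (Cn * e) := by
      have : Real.log (B * 2 ^ n / c / (1 / 2 ^ n) + 1) ≤ B / c + 2 * n := by
        rw [Real.log_le_iff_le_exp (by positivity), Real.exp_add]
        have e1 : (2 : ℝ) ≤ Real.exp 1 := by linarith [Real.add_one_le_exp (1 : ℝ)]
        have e2 : (1 : ℝ) ≤ 2 ^ (2 * n) := one_le_pow₀ (by norm_num)
        calc B * 2 ^ n / c / (1 / 2 ^ n) + 1 = B / c * 2 ^ (2 * n) + 1 := by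
              field_simp; ring
          _ ≤ (B / c + 1) * 2 ^ (2 * n) := by linarith
          _ ≤ Real.exp (B / c) * Real.exp 1 ^ (2 * n) := by
              gcongr
              exact Real.add_one_le_exp _
          _ = _ := by rw [← Real.exp_nat_mul]; push_cast; ring_nf
      calc _ ≤ B / c + 2 * n := this
        _ ≤ (B / c + 2) * (n + 1) := by nlinarith
        _ ≤ (B / c + 2) * (n + 1) ^ 3 := by gcongr
        _ ≤ _ := by gcongr
    have t3 : ∑ i ∈ Finset.range (n + 1) ×ˢ Finset.range (2 * n + 1),
        (K * (1 + ω ^ i.1 * ω ^ i.2 * e) + ((i.2 : ℝ) + 1)) ≤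
        K * (2 * (Cn * e)) + K * (G * G) * e + 4 * (Cn * e) := by
      calc _ ≤ ∑ i ∈ Finset.range (n + 1) ×ˢ Finset.range (2 * n + 1),
            ((K + (2 * n + 1)) + K * e * (ω ^ i.1 * ω ^ i.2)) := by
            refine Finset.sum_le_sum fun i hi => ?_
            have : i.2 ≤ 2 * n := by
              simp only [Finset.mem_product, Finset.mem_range] at hi; omega
            have : (i.2 : ℝ) ≤ 2 * n := by exact_mod_cast this
            linarith
        _ = (n + 1) * (2 * n + 1) * (K + (2 * n + 1)) + K * e *
            ∑ i ∈ Finset.range (n + 1) ×ˢ Finset.range (2 * n + 1), (ω ^ i.1 * ω ^ i.2) := by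
            rw [Finset.sum_add_distrib, Finset.mul_sum, Finset.sum_const, Finset.card_product,
              Finset.card_range, Finset.card_range, nsmul_eq_mul]
            push_cast
            ring
        _ ≤ (n + 1) * (2 * n + 1) * (K + (2 * n + 1)) + K * e * (G * G) := by gcongr
        _ ≤ (K * (2 * (n + 1) ^ 3) + 4 * (n + 1) ^ 3) + K * e * (G * G) := by
            gcongr
            have a1 : ((n : ℝ) + 1) * (2 * n + 1) ≤ 2 * (n + 1) ^ 3 := by
              have : 0 ≤ (n : ℝ) ^ 3 := by positivity
              nlinarith
            have a2 : ((n : ℝ) + 1) * (2 * n + 1) * (2 * n + 1) ≤ 4 * (n + 1) ^ 3 := by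
              nlinarith
            have := mul_le_mul_of_nonneg_left a1 hK.le
            linarith
        _ ≤ (K * (2 * (Cn * e)) + 4 * (Cn * e)) + K * e * (G * G) := by gcongr
        _ = _ := by ring
    rw [← he]
    linarith
open MeasureTheory
open scoped ENNReal

lemma geo_rpow {u v a b q : ℝ} (hu : 0 < u) (hv : 0 < v) (ha : 0 ≤ a) (hb : 0 ≤ b)
    (hab : a + b = 1) : (u ^ a * v ^ b) ^ q ≤ a * u ^ q + b * v ^ q := by
  rw [Real.mul_rpow (by positivity) (by positivity), ← Real.rpow_mul hu.le, ← Real.rpow_mul hv.le,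
    mul_comm a q, mul_comm b q, Real.rpow_mul hu.le, Real.rpow_mul hv.le]
  exact Real.geom_mean_le_arith_mean2_weighted ha hb (by positivity) (by positivity) hab

lemma sconc_aux {s s' a b u v P : ℝ} (hs' : s' < 0) (hss : s' ≤ s) (hu : 0 < u) (hv : 0 < v)
    (ha : 0 ≤ a) (hb : 0 ≤ b) (hab : a + b = 1)
    (h0 : s = 0 → u ^ a * v ^ b ≤ P) (h1 : s ≠ 0 → (a * u ^ s + b * v ^ s) ^ (1 / s) ≤ P) :
    0 < P ∧ P ^ s' ≤ a * u ^ s' + b * v ^ s' := by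
  rcases eq_or_ne s 0 with hs | hs
  · have h := h0 hs
    have p : 0 < u ^ a * v ^ b := by positivity
    exact ⟨p.trans_le h, (Real.rpow_le_rpow_of_nonpos p h hs'.le).trans (geo_rpow hu hv ha hb hab)⟩
  · have h := h1 hs
    have hU : 0 < u ^ s := by positivity
    have hV : 0 < v ^ s := by positivity
    have p0 : 0 < a * u ^ s + b * v ^ s := by
      rcases ha.eq_or_lt with g | g
      · have : b = 1 := by linarith
        rw [← g, this]; linarith
      · have := mul_nonneg hb hV.le
        have := mul_pos g hU
        linarith
    have p : 0 < (a * u ^ s + b * v ^ s) ^ (1 / s) := by positivity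
    refine ⟨p.trans_le h, (Real.rpow_le_rpow_of_nonpos p h hs'.le).trans ?_⟩
    rw [← Real.rpow_mul p0.le, one_div_mul_eq_div]
    have e : ∀ w : ℝ, 0 < w → w ^ s' = (w ^ s) ^ (s' / s) := by
      intro w hw
      rw [← Real.rpow_mul hw.le, mul_div_cancel₀ _ hs]
    rw [e u hu, e v hv]
    rcases lt_or_gt_of_ne hs with g | g
    · have hq : 1 ≤ s' / s := by rw [le_div_iff_of_neg g]; linarith
      exact (convexOn_rpow hq).2 (Set.mem_Ici.2 hU.le) (Set.mem_Ici.2 hV.le) ha hb hab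
    · refine le_trans ?_ (geo_rpow hU hV ha hb hab)
      apply Real.rpow_le_rpow_of_nonpos (by positivity)
      · exact Real.geom_mean_le_arith_mean2_weighted ha hb hU.le hV.le hab
      · exact div_nonpos_of_nonpos_of_nonneg hs'.le g.le

lemma PMs_neg {M s : ℝ} {p : ℝ → ℝ} (h : p ∈ PMs M s) : (fun x => p (-x)) ∈ PMs M s := by
  obtain ⟨h1, h2, h3, h4, h5⟩ := h
  refine ⟨fun x => h1 _, ?_, ?_, fun x => h4 _, fun x hx => h5 _ (by rwa [abs_neg])⟩
  · rw [integral_neg_eq_self (fun x => p x)]; exact h2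
  · intro x y θ t0 t1 px py
    have := h3 (-x) (-y) θ t0 t1 px py
    have e : (1 - θ) * -x + θ * -y = -((1 - θ) * x + θ * y) := by ring
    rw [e] at this
    exact this

lemma env_aux {r B m : ℝ} {D : Set ℝ} {p φ : ℝ → ℝ} (hr : 0 < r) (hB : 0 < B) (hm : 0 < m)
    (hp0 : ∀ x, 0 ≤ p x) (hp1 : ∫ x, p x = 1) (hcv : ConvexOn ℝ D φ) (h0 : 0 ∈ D)
    (hφ0 : φ 0 ≤ B) (hφ : ∀ x ∈ D, m ≤ φ x) (hpφ : ∀ x ∈ D, p x = φ x ^ (-r)) {x : ℝ}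
    (hx : x ∈ D) (hx0 : 0 < x) : min m B / (2 * B) ^ r * x ≤ φ x := by
  have hIntg : Integrable p := by
    by_contra hh
    rw [integral_undef hh] at hp1
    exact zero_ne_one hp1
  have hy : 0 < φ x := hm.trans_le (hφ x hx)
  set lam := min 1 (B / φ x) with hlam
  have hl0 : 0 < lam := lt_min one_pos (by positivity)
  have hl1 : lam ≤ 1 := min_le_left _ _
  have hl2 : lam * φ x ≤ B := by rw [← le_div_iff₀ hy]; exact min_le_right _ _
  have hV : 0 < (2 * B) ^ r := by positivity
  have key : ∀ z ∈ Set.Icc 0 (lam * x), (2 * B) ^ (-r) ≤ p z := by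
    intro z hz
    have t0 : 0 ≤ z / x := div_nonneg hz.1 hx0.le
    have tl : z / x ≤ lam := by rw [div_le_iff₀ hx0]; exact hz.2
    have ez : (1 - z / x) • (0 : ℝ) + (z / x) • x = z := by
      simp only [smul_eq_mul, mul_zero, zero_add]; field_simp
    have hzD := hcv.1 h0 hx (by linarith : 0 ≤ 1 - z / x) t0 (sub_add_cancel 1 _)
    have hzφ := hcv.2 h0 hx (by linarith : 0 ≤ 1 - z / x) t0 (sub_add_cancel 1 _)
    rw [ez] at hzD hzφ
    simp only [smul_eq_mul] at hzφ
    rw [hpφ z hzD]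
    apply Real.rpow_le_rpow_of_nonpos (hm.trans_le (hφ z hzD)) _ (by linarith)
    have g1 : (1 - z / x) * φ 0 ≤ 1 * B := by
      have : 0 < φ 0 := hm.trans_le (hφ 0 h0)
      apply mul_le_mul _ hφ0 this.le (by norm_num)
      linarith
    have g2 : z / x * φ x ≤ lam * φ x := by gcongr
    linarith
  have hle : (2 * B) ^ (-r) * (lam * x) ≤ 1 := by
    rw [← hp1]
    calc (2 * B) ^ (-r) * (lam * x) = ∫ z in Set.Icc 0 (lam * x), (2 * B) ^ (-r) := by
          rw [setIntegral_const, smul_eq_mul, measureReal_def, Real.volume_Icc, sub_zero,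
            ENNReal.toReal_ofReal (by positivity), mul_comm]
      _ ≤ ∫ z in Set.Icc 0 (lam * x), p z := by
          apply setIntegral_mono_on _ hIntg.integrableOn measurableSet_Icc key
          exact integrableOn_const (by simp) (by simp)
      _ ≤ ∫ z, p z := setIntegral_le_integral hIntg (Filter.Eventually.of_forall hp0)
  rw [Real.rpow_neg (by positivity), inv_mul_le_iff₀ hV, mul_one] at hle
  rw [div_mul_eq_mul_div, div_le_iff₀ hV]
  rcases min_choice 1 (B / φ x) with g | g
  · rw [hlam, g, one_mul] at hle
    exact mul_le_mul ((min_le_left _ _).trans (hφ x hx)) hle hx0.le hy.le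
  · rw [hlam, g, div_mul_eq_mul_div, div_le_iff₀ hy] at hle
    have : min m B * x ≤ B * x := by gcongr; exact min_le_right _ _
    linarith

open Classical in
lemma half_mem {M s s' : ℝ} {p : ℝ → ℝ} (hM : 0 < M) (hs' : s' < 0) (hss : s' ≤ s)
    (h : p ∈ PMs M s) : (fun x => if 0 < x then p x else 0) ∈
      HC (-1 / s') (min (M ^ s') ((1 / M) ^ s') / (2 * (1 / M) ^ s') ^ (-1 / s')) (M ^ s')
        ((1 / M) ^ s') := by
  obtain ⟨h1, h2, h3, h4, h5⟩ := h
  have hpos : ∀ x : ℝ, |x| ≤ 1 → 0 < p x := fun x hx => lt_of_lt_of_le (by positivity) (h5 x hx)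
  have hub : ∀ x : ℝ, |x| ≤ 1 → p x ^ s' ≤ (1 / M) ^ s' := fun x hx =>
    Real.rpow_le_rpow_of_nonpos (by positivity) (h5 x hx) hs'.le
  have hlb : ∀ x ∈ {x | 0 < p x}, M ^ s' ≤ p x ^ s' := fun x hx =>
    Real.rpow_le_rpow_of_nonpos hx (h4 x) hs'.le
  have hr : 0 < -1 / s' := div_pos_of_neg_of_neg (by norm_num) hs'
  have hinv : ∀ x ∈ {x | 0 < p x}, p x = (p x ^ s') ^ (-(-1 / s')) := by
    intro x hx
    have hx : 0 < p x := hx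
    have e : s' * (-(-1 / s')) = 1 := by
      have := hs'.ne
      field_simp
    rw [← Real.rpow_mul hx.le, e, Real.rpow_one]
  have main : ∀ x ∈ {x | 0 < p x}, ∀ y ∈ {x | 0 < p x}, ∀ a b : ℝ, 0 ≤ a → 0 ≤ b → a + b = 1 →
      0 < p (a * x + b * y) ∧ p (a * x + b * y) ^ s' ≤ a * p x ^ s' + b * p y ^ s' := by
    intro x hx y hy a b ha hb hab
    have ea : a = 1 - b := by linarith
    obtain ⟨g1, g2⟩ := h3 x y b hb (by linarith) hx hy
    rw [← ea] at g1 g2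
    exact sconc_aux hs' hss hx hy ha hb hab g1 g2
  have hcv : ConvexOn ℝ {x | 0 < p x} (fun x => p x ^ s') :=
    ⟨fun x hx y hy a b ha hb hab => (main x hx y hy a b ha hb hab).1,
      fun x hx y hy a b ha hb hab => (main x hx y hy a b ha hb hab).2⟩
  have z0 : (0 : ℝ) ∈ {x | 0 < p x} := hpos 0 (by simp)
  have hB : 0 < (1 / M) ^ s' := by positivity
  refine ⟨{x | 0 < p x}, fun x => p x ^ s', hcv, hpos (-1) (by simp), z0, fun x hx => ⟨hlb x hx, ?_⟩,
    hub 0 (by simp), hub (-1) (by simp), fun x hx hx0 => ?_, fun x hx => ?_⟩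
  · rcases le_or_gt x 0 with g | g
    · have hx : 0 < p x := hx
      have : 0 ≤ p x ^ s' := by positivity
      refine le_trans ?_ this
      exact mul_nonpos_of_nonneg_of_nonpos (by positivity) g
    · exact env_aux hr hB (by positivity) h1 h2 hcv z0 (hub 0 (by simp)) hlb hinv hx g
  · simp only [hx0, if_true]
    exact hinv x hx
  · dsimp only
    split_ifs with g
    · by_contra hne
      exact hx ⟨lt_of_le_of_ne (h1 x) (Ne.symm hne), g⟩
    · rfl

lemma HC_env {r c m B : ℝ} (hr : 1 < r) (hc : 0 < c) (hm0 : 0 < m) :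
    ∃ E, 0 < E ∧ Br (HC r c m B) E 0 := by
  have hr1 : 0 < r - 1 := by linarith
  refine ⟨m ^ (-r) * 1 + c ^ (-r) * (1 ^ (1 - r) / (r - 1)), by positivity,
    (br_env (V := m ^ (-r)) (T := 1) hr hc (by positivity) one_pos).mono ?_ le_rfl le_rfl⟩
  rintro f ⟨D, φ, hcv, hm1, h0, hm, hB0, hB1, hf, hf0⟩
  refine ⟨fun x => ?_, fun x hx => hf0 x (fun h => by linarith [h.2]), fun x => ?_, fun x hx => ?_⟩ <;>
    by_cases g : x ∈ D ∧ 0 < x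
  · rw [hf x g.1 g.2]
    have := hm0.trans_le (hm x g.1).1
    positivity
  · rw [hf0 x g]
  · rw [hf x g.1 g.2]
    exact Real.rpow_le_rpow_of_nonpos hm0 (hm x g.1).1 (by linarith)
  · rw [hf0 x g]; positivity
  · rw [hf x g.1 g.2]
    exact Real.rpow_le_rpow_of_nonpos (by positivity) (hm x g.1).2 (by linarith)
  · rw [hf0 x g]; positivity

lemma combine {M s E A d : ℝ} {H : Set (ℝ → ℝ)} (hM : 0 < M) (hd : 0 < d)
    (hH : ∀ p ∈ PMs M s, (fun x => if 0 < x then p x else 0) ∈ H) (hE : 0 ≤ E) (h : Br H E A) :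
    Br (PMs M s) (E + E + 2 * d * M) (A + A) := by
  have b0 := br_loc (V := M) (X := 0) (d := d) hM.le le_rfl hd
  rw [zero_div, zero_add, Real.log_one] at b0
  have b := Br.add (F := PMs M s) (Br.add' h h.neg hE hE) b0 (by linarith) (by positivity) (by
    intro p hp
    refine ⟨_, ⟨_, hH p hp, _, ⟨_, hH _ (PMs_neg hp), fun x => rfl⟩, fun x => rfl⟩,
      fun x => if x = 0 then p 0 else 0, ⟨fun x => ?_, {0}, ?_, ?_, ?_⟩, fun x => ?_⟩
    · dsimp only
      split_ifs
      · exact ⟨hp.1 0, hp.2.2.2.1 0⟩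
      · exact ⟨le_rfl, hM.le⟩
    · rintro x rfl; simp
    · rintro x rfl y rfl; simpa using hd.le
    · intro x hx; exact if_neg hx
    · dsimp only
      rcases lt_trichotomy x 0 with g | g | g
      · rw [if_neg (by linarith), if_pos (by linarith), if_neg g.ne]; simp
      · subst g; simp
      · rw [if_pos g, if_neg (by linarith), if_neg g.ne']; simp)
  rwa [add_zero] at b

/-- Hellinger bracketing entropy of `P_{M,s}` for `M > 0` and `s > −1`:
`log N_{[]}(ε, P_{M,s}, H) ≲ ε^{−1/2}` with constant depending only on `M` and `s`. -/
theorem PMs_hellinger_bracketing_entropy (M s : ℝ) (hM : 0 < M) (hs : -1 < s) :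
    ∃ K > 0, ∀ ε > 0, ∃ N : ℕ, BrackH (PMs M s) ε N ∧
      Real.log N ≤ K * ε ^ (-(1 : ℝ) / 2) := by
  obtain ⟨s', hs1, hs2, hss⟩ : ∃ s' : ℝ, -1 < s' ∧ s' ≤ -1 / 2 ∧ s' ≤ s :=
    ⟨min s (-1 / 2), lt_min hs (by norm_num), min_le_right _ _, min_le_left _ _⟩
  have hs0 : s' < 0 := by linarith
  have hr : 1 < -1 / s' := by rw [lt_div_iff_of_neg hs0]; linarith
  have hr2 : -1 / s' ≤ 2 := by rw [div_le_iff_of_neg hs0]; linarith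
  set c := min (M ^ s') ((1 / M) ^ s') / (2 * (1 / M) ^ s') ^ (-1 / s') with hcd
  have hc : 0 < c := by positivity
  have hm0 : 0 < M ^ s' := by positivity
  have hB : 0 < (1 / M) ^ s' := by positivity
  obtain ⟨C, K, hC, hK, hhalf⟩ := half hr hr2 hc hm0 hB
  obtain ⟨E, hE, henv⟩ := HC_env (B := (1 / M) ^ s') hr hc hm0
  have hH := fun p (hp : p ∈ PMs M s) => half_mem hM hs0 hss hp
  set W := (C + C + 2 * M) + (E + E + 2 * 1 * M) + 1 with hW
  have hW1 : 1 ≤ W := by rw [hW]; linarith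
  have hW0 : 0 < W := by linarith
  refine ⟨(K + K) * W ^ ((1 : ℝ) / 2), by positivity, fun ε hε => ?_⟩
  rcases le_or_gt ε W with g | g
  · have hη : 0 < ε / W := by positivity
    have hη1 : ε / W ≤ 1 := by rwa [div_le_one hW0]
    have b := combine (d := (ε / W) ^ 2) hM (by positivity) hH (by positivity)
      (hhalf (ε / W) hη hη1)
    have e : (ε / W) ^ (-(1 : ℝ) / 2) = W ^ ((1 : ℝ) / 2) * ε ^ (-(1 : ℝ) / 2) := by
      rw [Real.div_rpow hε.le hW0.le, div_eq_mul_inv, ← Real.rpow_neg hW0.le, mul_comm]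
      norm_num
    rw [e] at b
    obtain ⟨N, h1, h2⟩ := b.toBrackH (by positivity) (ε := ε) (by
      have e1 : C * (ε / W) ^ 2 + C * (ε / W) ^ 2 + 2 * (ε / W) ^ 2 * M =
        (C + C + 2 * M) * (ε ^ 2 / W ^ 2) := by ring
      rw [e1]
      have e2 : C + C + 2 * M ≤ W ^ 2 := by
        have : W ≤ W ^ 2 := le_self_pow₀ hW1 (by norm_num)
        linarith
      calc _ ≤ W ^ 2 * (ε ^ 2 / W ^ 2) := by gcongr
        _ = ε ^ 2 := by field_simp
        _ ≤ _ := by nlinarith)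
    exact ⟨N, h1, h2.trans (le_of_eq (by rw [← add_mul, mul_assoc]))⟩
  · have b := combine (d := 1) hM one_pos hH hE.le henv
    obtain ⟨N, h1, h2⟩ := b.toBrackH (by norm_num) (ε := ε) (by
      have e2 : W ≤ W ^ 2 := le_self_pow₀ hW1 (by norm_num)
      have e3 : W ^ 2 ≤ ε ^ 2 := by gcongr
      nlinarith)
    refine ⟨N, h1, h2.trans ?_⟩
    rw [add_zero]
    positivity
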